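/- arXiv:2501.11125 — 3 statements merged into one kernel-verified Lean document; each statement's English description precedes it below -/
import Mathlib

section
/- Let V be an m-dimensional vector space over an algebraically closed field K, and let G be a Zariski-closed subgroup of GL(V) with identity component G°. If the image of the determinant map restricted to G° is an infinite subgroup of K^×, then d(G, V) < m. -/
open CategoryTheory MonoidalCategory Limits

noncomputable section

universe u

/-- The `n`-th tensor power of a representation, in the category `Rep k G`. -/
def tpow {k G : Type u} [Field k] [Monoid G] (V : Rep k G) : ℕ → Rep k G
  | 0 => 𝟙_ (Rep k G)
  | n + 1 => tpow V n ⊗ V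

/-- `TS V` : the number of trivial direct summands of `V`, counted with multiplicity, i.e.
the largest `n` such that the trivial representation on `k^n` is a direct summand of `V`. -/
def TS {k G : Type u} [Field k] [Monoid G] (V : Rep k G) : ℕ :=
  sSup {n : ℕ | ∃ W : Rep k G, Nonempty (V ≅ Rep.trivial k G (Fin n → k) ⊞ W)}

/-- `dG V = limsup_{n → ∞} TS(V^{⊗n})^(1/n)`. -/
def dG {k G : Type u} [Field k] [Monoid G] (V : Rep k G) : ℝ :=
  Filter.limsup (fun n : ℕ => (TS (tpow V n) : ℝ) ^ ((n : ℝ)⁻¹)) Filter.atTop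

/-- The representation on `k^m` induced by a group homomorphism to `GL_m(k)`. -/
def matRep {k G : Type u} [Field k] [Monoid G] {m : ℕ}
    (ρ : G →* Matrix.GeneralLinearGroup (Fin m) k) : Representation k G (Fin m → k) :=
  (Matrix.toLinAlgEquiv'.toRingEquiv.toRingHom.toMonoidHom).comp
    ((Units.coeHom (Matrix (Fin m) (Fin m) k)).comp ρ)

/-- A subset of `GL_m(k)` is Zariski closed if it is the intersection of `GL_m(k)` with the
zero locus of a set of polynomials in the matrix entries. -/
def IsZariskiClosedGL {k : Type u} [Field k] {m : ℕ}
    (Z : Set (Matrix.GeneralLinearGroup (Fin m) k)) : Prop :=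
  ∃ S : Set (MvPolynomial (Fin m × Fin m) k),
    Z = {g : Matrix.GeneralLinearGroup (Fin m) k | ∀ f ∈ S,
      MvPolynomial.eval (fun q : Fin m × Fin m => (g.val : Matrix (Fin m) (Fin m) k) q.1 q.2) f = 0}

/-- The Zariski closure of a subset of `GL_m(k)`: the smallest Zariski-closed subset
containing it. -/
def zariskiClosure {k : Type u} [Field k] {m : ℕ}
    (X : Set (Matrix.GeneralLinearGroup (Fin m) k)) :
    Set (Matrix.GeneralLinearGroup (Fin m) k) :=
  ⋂₀ {Z | IsZariskiClosedGL Z ∧ X ⊆ Z}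

/-- The Zariski topology on `GL_m(k)`. -/
def zariskiTopologyGL {k : Type u} [Field k] {m : ℕ} :
    TopologicalSpace (Matrix.GeneralLinearGroup (Fin m) k) :=
  TopologicalSpace.generateFrom {U | IsZariskiClosedGL Uᶜ}

/-- The identity component of a subset of `GL_m(k)`: the connected component of the identity
element for the Zariski topology. -/
def identityComponent {k : Type u} [Field k] {m : ℕ}
    (X : Set (Matrix.GeneralLinearGroup (Fin m) k)) :
    Set (Matrix.GeneralLinearGroup (Fin m) k) :=
  @connectedComponentIn _ zariskiTopologyGL X 1

/-- `f` is triangular in the basis `b`, with diagonal entries `d`, for the order on the basis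
given by the rank function `r`: off the diagonal, `f` strictly lowers the rank. -/
structure IsTriangularIn {k U ι : Type*} [Field k] [AddCommGroup U] [Module k U]
    (b : Module.Basis ι k U) (f : Module.End k U) (r : ι → ℕ) (d : ι → k) : Prop where
  diag : ∀ i, b.repr (f (b i)) i = d i
  rank_lt : ∀ i j, i ≠ j → b.repr (f (b j)) i ≠ 0 → r i < r j

section Triangular

variable {k : Type*} [Field k]

/-- Over an algebraically closed field every endomorphism is triangularizable. -/
theorem exists_isTriangularIn [IsAlgClosed k] {n : ℕ} :
    ∀ {U : Type u} [AddCommGroup U] [Module k U] [FiniteDimensional k U]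
      (f : Module.End k U), Module.finrank k U = n →
      ∃ (b : Module.Basis (Fin n) k U) (d : Fin n → k),
        IsTriangularIn b f (fun i => (i.rev : ℕ)) d := by
  induction n with
  | zero =>
    intro U _ _ _ f hU
    exact ⟨Module.finBasisOfFinrankEq k U hU, Fin.elim0, ⟨fun i => i.elim0, fun i => i.elim0⟩⟩
  | succ n ih =>
    intro U _ _ _ f hU
    have : Nontrivial U := Module.nontrivial_of_finrank_eq_succ hU
    obtain ⟨c, hc⟩ := Module.End.exists_eigenvalue f
    have hlt : LinearMap.range (f - c • (1 : Module.End k U)) < ⊤ := by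
      rw [lt_top_iff_ne_top, ne_eq, LinearMap.range_eq_top, ← LinearMap.injective_iff_surjective,
        ← LinearMap.ker_eq_bot]
      rwa [Module.End.hasEigenvalue_iff, Module.End.eigenspace_def] at hc
    obtain ⟨φ, hφ, hle⟩ := Submodule.exists_le_ker_of_lt_top _ hlt
    obtain ⟨y, hy⟩ : ∃ y, φ y = 1 := by
      obtain ⟨z, hz⟩ := DFunLike.ne_iff.mp hφ
      exact ⟨(φ z)⁻¹ • z, by simpa using inv_mul_cancel₀ hz⟩
    have hsub (x : U) : f x - c • x ∈ LinearMap.ker φ := hle ⟨x, by simp⟩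
    have hinv : ∀ x ∈ LinearMap.ker φ, f x ∈ LinearMap.ker φ := fun x hx => by
      simpa using add_mem (hsub x) (Submodule.smul_mem _ c hx)
    have hN : Module.finrank k (LinearMap.ker φ) = n := by
      have := Module.Dual.finrank_ker_add_one_of_ne_zero hφ
      omega
    obtain ⟨b, d, hb⟩ := ih (f.restrict hinv) hN
    set B := Module.Basis.mkFinCons y b
      (fun a x hx h => by simpa [LinearMap.mem_ker.mp hx, hy] using congr(φ $h))
      (fun z => ⟨-φ z, by simp [hy]⟩) with hB
    have hB0 : B 0 = y := by simp [hB]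
    have hBs (i : Fin n) : B i.succ = b i := by simp [hB]
    have hrepr (x : LinearMap.ker φ) :
        B.repr x = (Finsupp.mapDomain Fin.succ (b.repr x)) := by
      apply B.repr.symm.injective
      rw [LinearEquiv.symm_apply_apply, Module.Basis.repr_symm_apply,
        Finsupp.linearCombination_mapDomain]
      conv_lhs => rw [← b.linearCombination_repr x]
      simp [Finsupp.linearCombination_apply, Finsupp.sum, hBs]
    have hrepr0 (x : LinearMap.ker φ) : B.repr x 0 = 0 := by
      rw [hrepr, Finsupp.mapDomain_of_notMem_range]
      simp
    have hreprs (x : LinearMap.ker φ) (i : Fin n) : B.repr x i.succ = b.repr x i := by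
      rw [hrepr, Finsupp.mapDomain_apply (Fin.succ_injective n)]
    have hfs (j : Fin n) : f (B j.succ) = (f.restrict hinv (b j) : LinearMap.ker φ) := by
      rw [hBs]; rfl
    have hf0 : f (B 0) = c • B 0 + ((⟨f y - c • y, hsub y⟩ : LinearMap.ker φ) : U) := by
      simp [hB0]
    refine ⟨B, Fin.cons c d, ⟨fun i => ?_, fun i j hij h => ?_⟩⟩
    · refine Fin.cases ?_ (fun i => ?_) i
      · rw [hf0, map_add, Finsupp.add_apply, hrepr0]
        simp
      · rw [hfs, hreprs, Fin.cons_succ]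
        exact hb.diag i
    · revert hij h
      refine Fin.cases ?_ (fun j => ?_) j <;> refine Fin.cases ?_ (fun i => ?_) i
      · simp
      · intro _ _
        simp only [Fin.val_rev, Fin.val_succ, Fin.val_zero]
        omega
      · rw [hfs, hrepr0]
        simp
      · intro hij h
        rw [hfs, hreprs] at h
        have := hb.rank_lt i j (by simpa using hij) h
        simp only [Fin.val_rev, Fin.val_succ] at this ⊢
        omega

variable {U W ι κ : Type*} [AddCommGroup U] [Module k U] [AddCommGroup W] [Module k W]

theorem IsTriangularIn.det_eq {n : ℕ} {b : Module.Basis (Fin n) k U} {f : Module.End k U}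
    {d : Fin n → k} (h : IsTriangularIn b f (fun i => (i.rev : ℕ)) d) :
    LinearMap.det f = ∏ i, d i := by
  rw [← LinearMap.det_toMatrix b, Matrix.det_of_isLowerTriangular]
  · simp [LinearMap.toMatrix_apply, h.diag]
  · intro i j hij
    by_contra hne
    rw [LinearMap.toMatrix_apply] at hne
    have hij' : i < j := hij
    have := h.rank_lt i j hij'.ne hne
    simp only [Fin.val_rev] at this
    omega

theorem IsTriangularIn.tensor {b : Module.Basis ι k U} {f : Module.End k U} {r : ι → ℕ}
    {d : ι → k} {c : Module.Basis κ k W} {g : Module.End k W} {s : κ → ℕ} {e : κ → k}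
    (hf : IsTriangularIn b f r d) (hg : IsTriangularIn c g s e) :
    IsTriangularIn (b.tensorProduct c) (TensorProduct.map f g) (fun p => r p.1 + s p.2)
      (fun p => d p.1 * e p.2) where
  diag := by
    rintro ⟨i, j⟩
    simp [Module.Basis.tensorProduct_apply, hf.diag, hg.diag, mul_comm]
  rank_lt := by
    rintro ⟨i, j⟩ ⟨i', j'⟩ hne h
    simp only [Module.Basis.tensorProduct_apply, TensorProduct.map_tmul,
      Module.Basis.tensorProduct_repr_tmul_apply, smul_eq_mul, ne_eq, mul_eq_zero, not_or] at h
    have h1 := hf.rank_lt i i'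
    have h2 := hg.rank_lt j j'
    by_cases hi : i = i'
    · subst hi
      have := h2 (by rintro rfl; exact hne rfl) h.1
      simpa using this
    · have h1 := h1 hi h.2
      by_cases hj : j = j'
      · subst hj
        simpa using h1
      · exact Nat.add_lt_add h1 (h2 hj h.1)

theorem IsTriangularIn.reindex {b : Module.Basis ι k U} {f : Module.End k U} {r : ι → ℕ}
    {d : ι → k} (hf : IsTriangularIn b f r d) (e : ι ≃ κ) :
    IsTriangularIn (b.reindex e) f (r ∘ e.symm) (d ∘ e.symm) where
  diag i := by simp [hf.diag]
  rank_lt i j hij h := hf.rank_lt _ _ (by simpa using hij) (by simpa using h)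

/-- The fixed space of a triangular endomorphism has dimension at most the number of diagonal
entries equal to `1`. -/
theorem IsTriangularIn.finrank_le [Fintype ι] {b : Module.Basis ι k U} {f : Module.End k U}
    {r : ι → ℕ} {d : ι → k} (hf : IsTriangularIn b f r d)
    (T : W →ₗ[k] U) (hT : Function.Injective T) (hfix : ∀ x, f (T x) = T x) :
    Module.finrank k W ≤ Nat.card {i // d i = 1} := by
  classical
  let Φ : W →ₗ[k] ({i // d i = 1} → k) :=
    LinearMap.pi fun i => (b.coord i.1) ∘ₗ T
  suffices hΦ : Function.Injective Φ by
    rw [Nat.card_eq_fintype_card]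
    simpa using LinearMap.finrank_le_finrank_of_injective hΦ
  rw [injective_iff_map_eq_zero]
  intro w hw
  rw [← hT.eq_iff, map_zero]
  set x := T w with hx
  have h1 (i : ι) (hi : d i = 1) : b.repr x i = 0 := congr_fun hw ⟨i, hi⟩
  by_contra hx0
  have hne : (b.repr x).support.Nonempty := by
    rw [Finsupp.support_nonempty_iff]; simpa using hx0
  obtain ⟨i, hi, hmax⟩ := Finset.exists_max_image _ r hne
  have hi0 : b.repr x i ≠ 0 := Finsupp.mem_support_iff.mp hi
  have key : b.repr (f x) i = d i * b.repr x i := by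
    conv_lhs => rw [← b.sum_repr x]
    rw [map_sum, map_sum, Finsupp.finsetSum_apply, Finset.sum_eq_single i]
    · simp [hf.diag, mul_comm]
    · intro j _ hji
      by_contra hne
      simp only [map_smul, Finsupp.smul_apply, smul_eq_mul, mul_eq_zero, not_or] at hne
      exact absurd (hf.rank_lt i j hji.symm hne.2)
        (hmax j (Finsupp.mem_support_iff.mpr hne.1)).not_gt
    · simp
  rw [hfix w] at key
  exact hi0 (h1 i (mul_right_cancel₀ hi0 (by rw [one_mul]; exact key.symm)))

end Triangular
section Counting

/-- An element of infinite order in a commutative group is detected by a real-valued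
additive character. -/
theorem exists_addMonoidHom_ne_zero {A : Type*} [AddCommGroup A] {x : A}
    (hx : ∀ n : ℕ, 0 < n → n • x ≠ 0) : ∃ φ : A →+ ℝ, φ x ≠ 0 := by
  have hinj : Function.Injective (zmultiplesHom A x) := by
    rw [injective_iff_map_eq_zero]
    intro n hn
    by_contra hn0
    refine hx n.natAbs (Int.natAbs_pos.mpr hn0) ?_
    rw [zmultiplesHom_apply] at hn
    rcases Int.natAbs_eq n with h | h <;> rw [h] at hn <;> simpa using hn
  obtain ⟨φ, hφ⟩ := (Module.Baer.of_divisible ℝ).extension_property_addMonoidHom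
    (zmultiplesHom A x) hinj (Int.castAddHom ℝ)
  exact ⟨φ, by
    have h := DFunLike.congr_fun hφ 1
    have h1 : φ x = 1 := by simpa using h
    simp [h1]⟩

/-- If real numbers have nonzero sum, some exponential tilt of them has total mass less than the
number of terms. -/
theorem exists_sum_exp_lt_card {ι : Type*} [Fintype ι] (a : ι → ℝ) (ha : ∑ i, a i ≠ 0) :
    ∃ t : ℝ, ∑ i, Real.exp (t * a i) < Fintype.card ι := by
  by_contra! h
  have hmin : IsLocalMin (fun t : ℝ => ∑ i, Real.exp (t * a i)) 0 :=
    Filter.Eventually.of_forall fun t => by simpa using h t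
  have hder : HasDerivAt (fun t : ℝ => ∑ i, Real.exp (t * a i)) (∑ i, a i) 0 := by
    refine HasDerivAt.fun_sum fun i _ => ?_
    simpa using ((hasDerivAt_id (0 : ℝ)).mul_const (a i)).exp
  exact ha (hmin.hasDerivAt_eq_zero hder)

/-- If the product of a finite family in a commutative group has infinite order, the number of
words of length `n` in the family with trivial product is exponentially smaller than the
number of all words. -/
theorem exists_card_words_le {ι M : Type*} [Fintype ι] [CommGroup M] (μ : ι → M)
    (hμ : ∀ n : ℕ, 0 < n → (∏ i, μ i) ^ n ≠ 1) :
    ∃ c : ℝ, 0 ≤ c ∧ c < Fintype.card ι ∧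
      ∀ n : ℕ, (Nat.card {w : Fin n → ι // ∏ t, μ (w t) = 1} : ℝ) ≤ c ^ n := by
  classical
  obtain ⟨φ, hφ⟩ := exists_addMonoidHom_ne_zero (x := Additive.ofMul (∏ i, μ i)) fun n hn h =>
    hμ n hn (Additive.ofMul.injective (by simpa using h))
  rw [ofMul_prod, map_sum] at hφ
  obtain ⟨t, ht⟩ := exists_sum_exp_lt_card (fun i => φ (Additive.ofMul (μ i))) hφ
  refine ⟨_, Finset.sum_nonneg fun i _ => (Real.exp_pos _).le, ht, fun n => ?_⟩
  rw [Fintype.sum_pow, Nat.card_eq_fintype_card, Fintype.card_subtype, Finset.card_eq_sum_ones,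
    Nat.cast_sum, Finset.sum_filter]
  refine Finset.sum_le_sum fun w _ => ?_
  split_ifs with hw
  · rw [← Real.exp_sum, ← Finset.mul_sum, ← map_sum, ← ofMul_prod, hw]
    simp
  · exact Finset.prod_nonneg fun i _ => (Real.exp_pos _).le

theorem germ_coe_prod {α ι M : Type*} [CommMonoid M] {l : Filter α} [Fintype ι] (f : ι → α → M) :
    ((fun a => ∏ i, f i a : α → M) : Filter.Germ l M) = ∏ i, (f i : Filter.Germ l M) := by
  rw [← Germ.coe_prod, Finset.prod_fn]

/-- A uniform version of `exists_card_words_le`: for a sequence of finite families in a group whose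
products have orders tending to infinity, for each length some member of the sequence has
few words with trivial product. -/
theorem exists_card_words_le_of_seq {ι M : Type*} [Fintype ι] [CommGroup M] (μ : ℕ → ι → M)
    (hμ : ∀ j n : ℕ, 0 < n → n ≤ j → (∏ i, μ j i) ^ n ≠ 1) :
    ∃ c : ℝ, 0 ≤ c ∧ c < Fintype.card ι ∧
      ∀ n : ℕ, ∃ j, (Nat.card {w : Fin n → ι // ∏ t, μ j (w t) = 1} : ℝ) ≤ c ^ n := by
  let l : Ultrafilter ℕ := Filter.hyperfilter ℕ
  let ν : ι → Filter.Germ (l : Filter ℕ) M := fun i => ((fun j => μ j i : ℕ → M) : Filter.Germ _ M)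
  have hν {N : Type} [Fintype N] (w : N → ι) :
      ∏ t, ν (w t) = ((fun j => ∏ t, μ j (w t) : ℕ → M) : Filter.Germ _ M) :=
    (germ_coe_prod _).symm
  obtain ⟨c, hc0, hc, hcard⟩ := exists_card_words_le ν fun n hn h => by
    rw [← germ_coe_prod, ← Filter.Germ.coe_pow, ← Filter.Germ.coe_one, Filter.Germ.coe_eq] at h
    have hge : ∀ᶠ j in (l : Filter ℕ), n ≤ j :=
      Nat.hyperfilter_le_atTop (Filter.eventually_ge_atTop n)
    obtain ⟨j, hj, hnj⟩ := (h.and hge).exists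
    exact hμ j n hn hnj hj
  refine ⟨c, hc0, hc, fun n => ?_⟩
  have hev : ∀ᶠ j in (l : Filter ℕ), ∀ w : Fin n → ι, ∏ t, μ j (w t) = 1 → ∏ t, ν (w t) = 1 := by
    rw [Filter.eventually_all]
    intro w
    by_cases h : ∏ t, ν (w t) = 1
    · exact Filter.Eventually.of_forall fun _ _ => h
    · have h' := h
      rw [hν, ← Filter.Germ.coe_one, Filter.Germ.coe_eq] at h'
      filter_upwards [Ultrafilter.eventually_not.mpr h'] with j hj hj'
      exact absurd hj' hj
  obtain ⟨j, hj⟩ := hev.exists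
  refine ⟨j, le_trans ?_ (hcard n)⟩
  exact_mod_cast Nat.card_le_card_of_injective (Subtype.map id hj)
    (Subtype.map_injective hj Function.injective_id)

/-- In an infinite set of elements of a domain, there are elements of arbitrarily large
multiplicative order. -/
theorem exists_pow_ne_one_of_infinite {R : Type*} [CommRing R] [IsDomain R] {S : Set R}
    (hS : S.Infinite) (N : ℕ) : ∃ x ∈ S, ∀ n : ℕ, 0 < n → n ≤ N → x ^ n ≠ 1 := by
  classical
  by_contra! h
  refine hS ((Polynomial.nthRootsFinset N.factorial (1 : R)).finite_toSet.subset fun x hx => ?_)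
  obtain ⟨n, hn, hnN, hxn⟩ := h x hx
  rw [Finset.mem_coe, Polynomial.mem_nthRootsFinset N.factorial_pos]
  obtain ⟨q, hq⟩ := Nat.dvd_factorial hn hnN
  rw [hq, pow_mul, hxn, one_pow]

end Counting

section TensorPowers

variable {k G : Type u} [Field k] [Monoid G]

/-- A triangular basis for the action of `g` on `V` induces one on every tensor power of `V`,
whose diagonal entries are the products of the diagonal entries on `V` along words. -/
theorem exists_isTriangularIn_tpow {ι : Type*} {V : Rep k G} {g : G} {b : Module.Basis ι k V}
    {r : ι → ℕ} {d : ι → k} (h : IsTriangularIn b (V.ρ g) r d) (n : ℕ) :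
    ∃ (B : Module.Basis (Fin n → ι) k (tpow V n)) (s : (Fin n → ι) → ℕ),
      IsTriangularIn B ((tpow V n).ρ g) s (fun w => ∏ t, d (w t)) := by
  induction n with
  | zero =>
    refine ⟨(Module.Basis.singleton (Fin 0 → ι) k : Module.Basis (Fin 0 → ι) k k), fun _ => 0,
      ⟨fun i => ?_, fun i j hij => absurd (Subsingleton.elim i j) hij⟩⟩
    change (Module.Basis.singleton (Fin 0 → ι) k).repr
      (Module.Basis.singleton (Fin 0 → ι) k i) i = _
    simp
  | succ n ih =>
    obtain ⟨B, s, hB⟩ := ih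
    let e : (Fin n → ι) × ι ≃ (Fin (n + 1) → ι) :=
      (Equiv.prodComm _ _).trans (Fin.snocEquiv fun _ => ι)
    have he : (fun w : Fin (n + 1) → ι => ∏ t, d (w t)) =
        (fun p : (Fin n → ι) × ι => (∏ t, d (p.1 t)) * d p.2) ∘ e.symm := by
      funext w
      rw [Fin.prod_univ_castSucc]
      rfl
    rw [he]
    exact ⟨_, _, (hB.tensor h).reindex e⟩

/-- The number of trivial direct summands is at most the number of diagonal entries equal to `1`
in a triangular form of the action of any given group element. -/
theorem TS_le_of_isTriangularIn {ι : Type*} [Fintype ι] {V : Rep k G} {g : G}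
    {b : Module.Basis ι k V} {r : ι → ℕ} {d : ι → k} (h : IsTriangularIn b (V.ρ g) r d) :
    TS V ≤ Nat.card {i // d i = 1} := by
  refine csSup_le' ?_
  rintro N ⟨W, ⟨e⟩⟩
  let i : Rep.trivial k G (Fin N → k) ⟶ V := biprod.inl ≫ e.inv
  have hmono : Mono i := inferInstance
  have := h.finrank_le i.hom.toLinearMap ((Rep.mono_iff_injective i).mp hmono)
    (fun x => (Rep.hom_comm_apply i g x).symm)
  simpa using this

theorem TS_tpow_le {ι : Type*} [Fintype ι] {V : Rep k G} {g : G}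
    {b : Module.Basis ι k V} {r : ι → ℕ} {d : ι → k} (h : IsTriangularIn b (V.ρ g) r d) (n : ℕ) :
    TS (tpow V n) ≤ Nat.card {w : Fin n → ι // ∏ t, d (w t) = 1} := by
  obtain ⟨B, s, hB⟩ := exists_isTriangularIn_tpow h n
  exact TS_le_of_isTriangularIn hB

theorem dG_le_of_TS_le_pow {V : Rep k G} {c : ℝ} (hc : 0 ≤ c)
    (h : ∀ n, (TS (tpow V n) : ℝ) ≤ c ^ n) : dG V ≤ c := by
  refine Filter.limsup_le_of_le (Filter.isCoboundedUnder_le_of_le Filter.atTop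
    (fun n => Real.rpow_nonneg (Nat.cast_nonneg _) _)) ?_
  filter_upwards [Filter.eventually_ne_atTop 0] with n hn
  calc (TS (tpow V n) : ℝ) ^ ((n : ℝ)⁻¹) ≤ (c ^ n) ^ ((n : ℝ)⁻¹) :=
        Real.rpow_le_rpow (Nat.cast_nonneg _) (h n) (by positivity)
    _ = c := Real.pow_rpow_inv_natCast hc hn

end TensorPowers

/-- It suffices that the determinant takes infinitely many values on `G`, which need not be
Zariski closed. -/
theorem dG_lt_of_det_infinite {k : Type u} [Field k] [IsAlgClosed k] {m : ℕ}
    (G : Subgroup (Matrix.GeneralLinearGroup (Fin m) k))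
    (hinf : ((fun g : Matrix.GeneralLinearGroup (Fin m) k => Matrix.det g.val) ''
      (G : Set (Matrix.GeneralLinearGroup (Fin m) k))).Infinite) :
    dG (Rep.of (matRep G.subtype)) < (m : ℝ) := by
  have hex (j : ℕ) : ∃ g : G, ∀ n : ℕ, 0 < n → n ≤ j → g.1.val.det ^ n ≠ 1 := by
    obtain ⟨_, ⟨g, hg, rfl⟩, h⟩ := exists_pow_ne_one_of_infinite hinf j
    exact ⟨⟨g, hg⟩, h⟩
  choose g hg using hex
  have htri (j : ℕ) := exists_isTriangularIn (matRep G.subtype (g j)) (by simp : _ = m)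
  choose b d hb using htri
  have hdet (j : ℕ) : (g j).1.val.det = ∏ i, d j i := by
    rw [← (hb j).det_eq]
    exact (LinearMap.det_toLin' _).symm
  have hne (j : ℕ) (i : Fin m) : d j i ≠ 0 := by
    have h : ∏ i, d j i ≠ 0 := by
      rw [← hdet]
      exact ((Matrix.isUnit_iff_isUnit_det _).mp (g j).1.isUnit).ne_zero
    exact Finset.prod_ne_zero_iff.mp h i (Finset.mem_univ i)
  obtain ⟨c, hc0, hc, hcard⟩ := exists_card_words_le_of_seq
    (fun j i => Units.mk0 (d j i) (hne j i)) fun j n hn hnj h => hg j n hn hnj <| by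
      simpa [hdet] using congr(($h : k))
  refine (dG_le_of_TS_le_pow hc0 fun n => ?_).trans_lt (by simpa using hc)
  obtain ⟨j, hj⟩ := hcard n
  refine le_trans (Nat.cast_le.mpr (TS_tpow_le (V := Rep.of (matRep G.subtype)) (hb j) n)) ?_
  simpa [Units.ext_iff] using hj

/-- **Theorem.** If the determinant takes infinitely many values on the identity component
of a Zariski-closed subgroup `G ≤ GL_m(k)`, then `d(G, V) < m`. -/
theorem dG_lt_of_det_infinite_on_identityComponent {k : Type u} [Field k] [IsAlgClosed k]
    {m : ℕ} (G : Subgroup (Matrix.GeneralLinearGroup (Fin m) k))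
    (hclosed : IsZariskiClosedGL (G : Set (Matrix.GeneralLinearGroup (Fin m) k)))
    (hinf : ((fun g : Matrix.GeneralLinearGroup (Fin m) k => Matrix.det g.val) ''
        identityComponent (G : Set (Matrix.GeneralLinearGroup (Fin m) k))).Infinite) :
    dG (Rep.of (matRep G.subtype)) < (m : ℝ) := by
  exact dG_lt_of_det_infinite G (hinf.mono (Set.image_mono (@connectedComponentIn_subset _
    zariskiTopologyGL _ _)))
end
end

section
/- Let K be algebraically closed of characteristic 0 and V = K^m the natural representation of SL_m(K). There exist constants C > 0 and k (depending only on m) and N such that for every n > N there is a partition λ of n with at most m parts that is close to the mean (|λ_i − n/m| < n^{2/3} for all i) and such that the multiplicity of the irreducible representation V_λ as a direct summand of V^{⊗n} is greater than C·m^n/n^k. -/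
open CategoryTheory MonoidalCategory Limits

noncomputable section

universe u

attribute [local instance] CategoryTheory.Abelian.hasFiniteBiproducts

/-- The natural `m`-dimensional representation of `SL_m(k)`. -/
def natRepSL (k : Type u) [Field k] (m : ℕ) : Rep k (Matrix.SpecialLinearGroup (Fin m) k) :=
  Rep.of (matRep Matrix.SpecialLinearGroup.toGL)

/-- A submodule is a subrepresentation if it is stable under the group action. -/
def IsSubrep {k G V : Type u} [Field k] [Monoid G] [AddCommGroup V] [Module k V]
    (ρ : Representation k G V) (U : Submodule k V) : Prop :=
  ∀ g : G, ∀ v ∈ U, ρ g v ∈ U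

/-- A representation is irreducible if it is nonzero and its only subrepresentations
are `⊥` and `⊤`. -/
def IsIrreducibleRep {k G V : Type u} [Field k] [Monoid G] [AddCommGroup V] [Module k V]
    (ρ : Representation k G V) : Prop :=
  (∃ v : V, v ≠ 0) ∧ ∀ U : Submodule k V, IsSubrep ρ U → U = ⊥ ∨ U = ⊤

/-- `v` is a highest weight vector of weight `lam` for a representation `W` of `SL_m(k)`:
`v` is nonzero, fixed by all upper unitriangular matrices, and an eigenvector for every
diagonal torus element `diag(t_1, …, t_m)` with eigenvalue `∏ t_i ^ lam i`. -/
def IsHighestWeightVector {k : Type u} [Field k] {m : ℕ}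
    (W : Rep k (Matrix.SpecialLinearGroup (Fin m) k)) (lam : Fin m → ℕ) (v : W.V) : Prop :=
  v ≠ 0 ∧
    (∀ g : Matrix.SpecialLinearGroup (Fin m) k,
      (∀ i : Fin m, (g : Matrix (Fin m) (Fin m) k) i i = 1) →
      (∀ i j : Fin m, j < i → (g : Matrix (Fin m) (Fin m) k) i j = 0) →
      W.ρ g v = v) ∧
    (∀ g : Matrix.SpecialLinearGroup (Fin m) k, ((g : Matrix (Fin m) (Fin m) k)).IsDiag →
      W.ρ g v = (∏ i : Fin m, (g : Matrix (Fin m) (Fin m) k) i i ^ lam i) • v)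

/-- A representation of `SL_m(k)` has highest weight `lam` if it contains a highest weight
vector of weight `lam`. -/
def HasHighestWeight {k : Type u} [Field k] {m : ℕ}
    (W : Rep k (Matrix.SpecialLinearGroup (Fin m) k)) (lam : Fin m → ℕ) : Prop :=
  ∃ v : W.V, IsHighestWeightVector W lam v

/-- An object of `Rep k G` is irreducible. -/
def RepIrreducible {k G : Type u} [Field k] [Monoid G] (W : Rep k G) : Prop :=
  IsIrreducibleRep W.ρ

/-- The multiplicity of `A` as a direct summand of `B`: the largest `r` such that `A^{⊕r}`
is a direct summand of `B`. -/
def multiplicityIn {k G : Type u} [Field k] [Monoid G] (A B : Rep k G) : ℕ :=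
  sSup {r : ℕ | ∃ W : Rep k G, Nonempty (B ≅ (⨁ fun _ : Fin r => A) ⊞ W)}

section Abstract

variable {k A : Type*} [Field k] [Ring A] [Algebra k A] [Module.Finite k A]

theorem card_isotypicComponents_le_finrank :
    Nat.card (isotypicComponents A A) ≤ Module.finrank k A := by
  have : IsNoetherian A A := isNoetherian_of_tower k inferInstance
  have := Fintype.ofFinite (isotypicComponents A A)
  classical
  let p : isotypicComponents A A → Submodule k A := fun c => c.1.restrictScalars k
  have hp : iSupIndep p := by
    have h := (sSupIndep_iff _).mp (sSupIndep_isotypicComponents A A)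
    intro i
    have hi := h i
    rw [disjoint_iff] at hi ⊢
    have : ⨆ j, ⨆ (_ : j ≠ i), p j
        ≤ (⨆ j, ⨆ (_ : j ≠ i), (j : Submodule A A)).restrictScalars k :=
      iSup₂_le fun j hj =>
        le_iSup₂_of_le (f := fun j (_ : j ≠ i) => (j : Submodule A A)) j hj le_rfl
    rw [eq_bot_iff] at hi ⊢
    exact fun x hx => hi ⟨hx.1, this hx.2⟩
  have hne : ∀ i, p i ≠ ⊥ := fun i hi =>
    (bot_lt_isotypicComponents i.2).ne' ((Submodule.restrictScalars_eq_bot_iff k A A).mp hi)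
  refine le_trans ?_ hp.subtype_ne_bot_le_finrank
  rw [Nat.card_eq_fintype_card]
  exact (Fintype.card_congr (Equiv.subtypeUnivEquiv hne).symm).le

variable {X : Type*} [AddCommGroup X] [Module k X] [Module A X] [IsScalarTower k A X]

theorem finrank_le_of_isSimpleModule (k A : Type*) [Field k] [Ring A] [Algebra k A]
    [Module.Finite k A] (X : Type*) [AddCommGroup X] [Module k X] [Module A X]
    [IsScalarTower k A X] [IsSimpleModule A X] : Module.finrank k X ≤ Module.finrank k A := by
  have := IsSimpleModule.nontrivial A X
  obtain ⟨x, hx⟩ := exists_ne (0 : X)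
  exact ((LinearMap.toSpanSingleton A X x).restrictScalars k).finrank_le_finrank_of_surjective
    (IsSimpleModule.toSpanSingleton_surjective A hx)

theorem exists_isotypicComponents_of_isSimpleModule [IsSemisimpleRing A]
    (S : Type*) [AddCommGroup S] [Module A S] [IsSimpleModule A S] :
    ∃ c : isotypicComponents A A, c.1 = isotypicComponent A A S := by
  obtain ⟨I, ⟨e⟩⟩ := IsSemisimpleRing.exists_linearEquiv_ideal_of_isSimpleModule A S
  have := IsSimpleModule.congr e.symm
  exact ⟨⟨isotypicComponent A A S, I, this, e.isotypicComponent_eq⟩, rfl⟩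

theorem nonempty_linearEquiv_of_isotypicComponent_eq [IsSemisimpleRing A]
    {S T : Type*} [AddCommGroup S] [Module A S] [IsSimpleModule A S]
    [AddCommGroup T] [Module A T] [IsSimpleModule A T]
    (h : isotypicComponent A A S = isotypicComponent A A T) : Nonempty (S ≃ₗ[A] T) := by
  obtain ⟨I, ⟨e⟩⟩ := IsSemisimpleRing.exists_linearEquiv_ideal_of_isSimpleModule A S
  have := IsSimpleModule.congr e.symm
  have hI : I ≤ isotypicComponent A A T :=
    (I.le_isotypicComponent.trans_eq (e.isotypicComponent_eq (M := A)).symm).trans_eq h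
  obtain ⟨e'⟩ := isIsotypicOfType_submodule_iff.mp (.isotypicComponent A A T) I hI
  exact ⟨e.trans e'⟩

/-- If every simple submodule of `X` either is good or meets a small subspace `E`, then some good
simple submodule occurs often as a direct summand of `X`. -/
theorem exists_isSimpleModule_with_many_copies [IsSemisimpleRing A] [Module.Finite k X]
    (E : Submodule k X) (Good : Submodule A X → Prop)
    (hE : ∀ T : Submodule A X, IsSimpleModule A T → ¬ Good T → ∃ v ∈ T, v ∈ E ∧ v ≠ 0)
    (r : ℕ) (hr : Module.finrank k A * (Module.finrank k E + Module.finrank k A * r)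
      < Module.finrank k X) :
    ∃ T : Submodule A X, IsSimpleModule A T ∧ Good T ∧
      ∃ (inc : Fin (r + 1) → (T →ₗ[A] X)) (proj : Fin (r + 1) → (X →ₗ[A] T)),
        ∀ i j, proj i ∘ₗ inc j = if i = j then LinearMap.id else 0 := by
  classical
  have : Module.Finite A X := .of_restrictScalars_finite k A X
  obtain ⟨N, S, e, hS⟩ := IsSemisimpleModule.exists_linearEquiv_fin_dfinsupp A X
  let ι (i : Fin N) : S i →ₗ[A] X :=
    e.symm.toLinearMap ∘ₗ DFinsupp.lsingle (R := A) (M := fun j => S j) i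
  let π (i : Fin N) : X →ₗ[A] S i :=
    DFinsupp.lapply (R := A) (M := fun j => S j) i ∘ₗ e.toLinearMap
  have hπι (i j) (h : i ≠ j) : π i ∘ₗ ι j = 0 := by
    ext x; simp [ι, π, DFinsupp.single_apply, h.symm]
  have hπι' (i) : π i ∘ₗ ι i = LinearMap.id := by
    ext x; simp [ι, π]
  have hinj (i) : Function.Injective (ι i) :=
    e.symm.injective.comp (DFinsupp.single_injective (β := fun j => S j))
  let T (i : Fin N) : Submodule A X := LinearMap.range (ι i)
  let eT (i : Fin N) : S i ≃ₗ[A] T i := LinearEquiv.ofInjective (ι i) (hinj i)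
  have hT (i) : IsSimpleModule A (T i) := .congr (eT i).symm
  have hfin (i) : Module.Finite k (S i) :=
    inferInstanceAs (Module.Finite k ((S i).restrictScalars k))
  -- the number of simple summands
  have hN : Module.finrank k X ≤ Module.finrank k A * N := by
    rw [(e.restrictScalars k).finrank_eq, (DFinsupp.linearEquivFunOnFintype (R := k)).finrank_eq,
      Module.finrank_pi_fintype, mul_comm]
    refine (Finset.sum_le_card_nsmul _ _ (Module.finrank k A) fun i _ =>
      finrank_le_of_isSimpleModule k A (S i)).trans ?_
    simp
  -- the number of bad summands
  let bad : Finset (Fin N) := {i | ¬ Good (T i)}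
  have hbad : bad.card ≤ Module.finrank k E := by
    have hv (i : bad) : ∃ v ∈ T i, v ∈ E ∧ v ≠ 0 :=
      hE _ (hT i) (Finset.mem_filter.mp i.2).2
    choose v hvT hvE hv0 using hv
    have hli : LinearIndependent k v := by
      choose s hs using hvT
      rw [Fintype.linearIndependent_iff]
      intro g hg i
      have h1 := congrArg (π i) hg
      rw [map_sum, map_zero, Finset.sum_eq_single i] at h1
      · rw [← hs i, ← LinearMap.map_smul_of_tower] at h1
        have h2 := LinearMap.congr_fun (hπι' i) (g i • s i)
        rw [LinearMap.comp_apply, h1] at h2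
        refine (smul_eq_zero.mp h2.symm).resolve_right fun h3 => hv0 i ?_
        rw [← hs i, h3, map_zero]
      · intro j _ hj
        rw [← hs j, ← LinearMap.map_smul_of_tower]
        exact LinearMap.congr_fun (hπι i j fun h => hj (Subtype.ext h.symm)) _
      · simp
    have hli' : LinearIndependent k (fun i => (⟨v i, hvE i⟩ : E)) :=
      LinearIndependent.of_comp E.subtype hli
    simpa using hli'.fintype_card_le_finrank
  let good : Finset (Fin N) := {i | Good (T i)}
  have hgb : good.card + bad.card = N := by
    simpa [good, bad] using Finset.card_filter_add_card_filter_not (s := Finset.univ)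
      (fun i : Fin N => Good (T i))
  have hgood : Module.finrank k A * r < good.card := by
    have h1 := lt_of_mul_lt_mul_left (hr.trans_le hN) (Nat.zero_le _)
    omega
  -- pigeonhole on isomorphism classes
  have : IsNoetherian A A := isNoetherian_of_tower k inferInstance
  have := Fintype.ofFinite (isotypicComponents A A)
  have hcl (i : Fin N) := exists_isotypicComponents_of_isSimpleModule (A := A) (S i)
  choose cl hcl using hcl
  obtain ⟨c, -, hc⟩ := Finset.exists_lt_card_fiber_of_mul_lt_card_of_maps_to (s := good)
    (t := Finset.univ) (f := cl) (n := r) (fun _ _ => Finset.mem_univ _) (by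
      refine lt_of_le_of_lt (Nat.mul_le_mul_right _ ?_) hgood
      rw [Finset.card_univ, ← Nat.card_eq_fintype_card]
      exact card_isotypicComponents_le_finrank)
  obtain ⟨J, hJ, hJc⟩ := Finset.exists_subset_card_eq (Nat.succ_le_of_lt hc)
  let f := J.equivFinOfCardEq hJc
  have hf (i) : (f.symm i : Fin N) ∈ good ∧ cl (f.symm i) = c := by
    simpa using hJ (f.symm i).2
  have hiso (i : Fin (r + 1)) : Nonempty (T (f.symm 0) ≃ₗ[A] S (f.symm i)) := by
    obtain ⟨e'⟩ : Nonempty (S (f.symm 0) ≃ₗ[A] S (f.symm i)) :=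
      nonempty_linearEquiv_of_isotypicComponent_eq
        (by rw [← hcl, ← hcl, (hf 0).2, (hf i).2])
    exact ⟨(eT _).symm.trans e'⟩
  let g i := (hiso i).some
  refine ⟨T (f.symm 0), hT _, by simpa [good] using (hf 0).1,
    fun i => ι (f.symm i) ∘ₗ (g i).toLinearMap, fun i => (g i).symm.toLinearMap ∘ₗ π (f.symm i), ?_⟩
  intro i j
  split_ifs with h
  · subst h
    ext x : 1
    have := LinearMap.congr_fun (hπι' (f.symm i)) (g i x)
    simp only [LinearMap.comp_apply, LinearEquiv.coe_coe, LinearMap.id_apply] at this ⊢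
    rw [this, LinearEquiv.symm_apply_apply]
  · ext x : 1
    have := LinearMap.congr_fun (hπι (f.symm i) (f.symm j) (by
      intro h'; exact h (f.symm.injective (Subtype.ext h')))) (g j x)
    simp only [LinearMap.comp_apply, LinearEquiv.coe_coe, LinearMap.zero_apply] at this ⊢
    rw [this]
    exact map_zero (g i).symm

end Abstract

theorem le_multiplicityIn {k G : Type u} [Field k] [Group G] {W B : Rep k G}
    [FiniteDimensional k B.V] [Nontrivial W.V] {r : ℕ}
    (inc : Fin r → (W ⟶ B)) (proj : Fin r → (B ⟶ W))
    (h : ∀ i j, inc j ≫ proj i = if i = j then 𝟙 W else 0) :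
    r ≤ multiplicityIn W B := by
  refine le_csSup ⟨Module.finrank k B.V, ?_⟩ ?_
  · rintro s ⟨W', ⟨e⟩⟩
    let ι (i : Fin s) : W ⟶ B := biproduct.ι (fun _ : Fin s => W) i ≫ biprod.inl ≫ e.inv
    let π (i : Fin s) : B ⟶ W := e.hom ≫ biprod.fst ≫ biproduct.π (fun _ : Fin s => W) i
    have hιπ (i j) : ι j ≫ π i = if i = j then 𝟙 W else 0 := by
      simp only [ι, π, Category.assoc, Iso.inv_hom_id_assoc, biprod.inl_fst_assoc,
        biproduct.ι_π]
      split_ifs <;> simp_all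
    obtain ⟨w, hw⟩ := exists_ne (0 : W.V)
    have hli : LinearIndependent k (fun i => (ι i).hom w) := by
      rw [Fintype.linearIndependent_iff]
      intro g hg i
      have h1 := congrArg (π i).hom hg
      rw [map_sum, map_zero, Finset.sum_eq_single i] at h1
      · rw [map_smul, ← Rep.comp_apply, hιπ, if_pos rfl, Rep.id_apply] at h1
        exact (smul_eq_zero.mp h1).resolve_right hw
      · intro j _ hj
        rw [map_smul, ← Rep.comp_apply, hιπ, if_neg hj.symm]
        exact smul_zero _
      · simp
    simpa using hli.fintype_card_le_finrank
  · let f : (⨁ fun _ : Fin r => W) ⟶ B := biproduct.desc inc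
    have hf : f ≫ biproduct.lift proj = 𝟙 _ := by
      refine biproduct.hom_ext' _ _ fun j => biproduct.hom_ext _ _ fun i => ?_
      simp only [f, Category.assoc, biproduct.lift_π, biproduct.ι_desc_assoc, h, Category.comp_id,
        biproduct.ι_π]
      split_ifs <;> simp_all
    have : IsSplitMono f := ⟨⟨⟨_, hf⟩⟩⟩
    exact ⟨_, ⟨biprod.uniqueUpToIso _ _
      (isBilimitBinaryBiconeOfIsSplitMonoOfCokernel (cokernelIsCokernel f))⟩⟩

section Words

open Matrix

variable {k : Type u} [Field k] {m n : ℕ}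

/-- The matrix of the `n`-th tensor power of `g`, with rows and columns indexed by words. -/
def tensorPowMatrix (n : ℕ) (g : Matrix (Fin m) (Fin m) k) :
    Matrix (Fin n → Fin m) (Fin n → Fin m) k :=
  Matrix.of fun w w' => ∏ t, g (w t) (w' t)

theorem tensorPowMatrix_mul (g h : Matrix (Fin m) (Fin m) k) :
    tensorPowMatrix n (g * h) = tensorPowMatrix n g * tensorPowMatrix n h := by
  ext w w'
  simp only [tensorPowMatrix, Matrix.of_apply, Matrix.mul_apply, Finset.prod_univ_sum,
    Fintype.piFinset_univ, Finset.prod_mul_distrib]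

theorem tensorPowMatrix_one : tensorPowMatrix n (1 : Matrix (Fin m) (Fin m) k) = 1 := by
  ext w w'
  simp only [tensorPowMatrix, Matrix.of_apply, Matrix.one_apply, Finset.prod_ite_zero]
  simp [funext_iff]

/-- Coordinates on `V ⊗ K^m` in terms of coordinates on `V`. -/
def snocCoordinates {V : Type*} [AddCommGroup V] [Module k V]
    (e : V ≃ₗ[k] ((Fin n → Fin m) → k)) :
    TensorProduct k V (Fin m → k) ≃ₗ[k] ((Fin (n + 1) → Fin m) → k) :=
  (TensorProduct.congr e (LinearEquiv.refl k (Fin m → k))).trans <|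
  (TensorProduct.piScalarRight k k ((Fin n → Fin m) → k) (Fin m)).trans <|
  (LinearEquiv.curry k k (Fin m) (Fin n → Fin m)).symm.trans <|
  LinearEquiv.funCongrLeft k k (Fin.snocEquiv fun _ => Fin m).symm

theorem snocCoordinates_map {V : Type*} [AddCommGroup V] [Module k V]
    (e : V ≃ₗ[k] ((Fin n → Fin m) → k)) (g : Matrix (Fin m) (Fin m) k) (L : V →ₗ[k] V)
    (hL : ∀ x, e (L x) = tensorPowMatrix n g *ᵥ e x) (x : TensorProduct k V (Fin m → k)) :
    snocCoordinates e (TensorProduct.map L (Matrix.toLin' g) x)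
      = tensorPowMatrix (n + 1) g *ᵥ snocCoordinates e x := by
  have hφ (x : V) (f : Fin m → k) (w) :
      snocCoordinates e (x ⊗ₜ[k] f) w = f (w (Fin.last n)) * e x (Fin.init w) := by
    rfl
  induction x using TensorProduct.induction_on with
  | zero => rw [map_zero, map_zero, mulVec_zero]
  | add x y hx hy => rw [map_add, map_add, map_add, hx, hy, mulVec_add]
  | tmul x f =>
    ext w
    rw [TensorProduct.map_tmul, hφ, hL, Matrix.toLin'_apply]
    simp only [mulVec, dotProduct, Finset.sum_mul_sum]
    rw [← (Fin.snocEquiv fun _ => Fin m).sum_comp, Fintype.sum_prod_type]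
    refine Finset.sum_congr rfl fun j _ => Finset.sum_congr rfl fun w' _ => ?_
    have hw : Fin.init ((Fin.snocEquiv fun _ => Fin m) (j, w')) = w' := by simp [Fin.snocEquiv]
    rw [hφ, hw]
    simp [tensorPowMatrix, Fin.prod_univ_castSucc, Fin.init]
    ring

/-- Coordinates on the `n`-th tensor power of the natural representation. -/
theorem exists_tpow_linearEquiv (n : ℕ) :
    ∃ e : (tpow (natRepSL k m) n).V ≃ₗ[k] ((Fin n → Fin m) → k), ∀ g x,
      e ((tpow (natRepSL k m) n).ρ g x)
        = tensorPowMatrix n (g : Matrix (Fin m) (Fin m) k) *ᵥ e x := by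
  induction n with
  | zero =>
    refine ⟨(LinearEquiv.funUnique (Fin 0 → Fin m) k k).symm, fun g (x : k) => ?_⟩
    change _ = _ *ᵥ (fun _ => x)
    ext w
    simp [tensorPowMatrix, Matrix.mulVec, dotProduct]
    rfl
  | succ n ih =>
    obtain ⟨e, he⟩ := ih
    exact ⟨snocCoordinates e, fun g x => snocCoordinates_map e _ _ (he g) x⟩

/-- The permutation representation of `S_n` on functions on words, by permuting letters. -/
def wordRep (k : Type u) [Field k] (m n : ℕ) :
    Representation k (Equiv.Perm (Fin n)) ((Fin n → Fin m) → k) where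
  toFun σ := LinearMap.funLeft k k fun w => w ∘ σ
  map_one' := rfl
  map_mul' _ _ := rfl

/-- The module of functions on words over the group algebra of `S_n`. -/
def WordModule (k : Type u) [Field k] (m n : ℕ) : Type u := (Fin n → Fin m) → k

instance : AddCommGroup (WordModule k m n) := inferInstanceAs (AddCommGroup ((Fin n → Fin m) → k))

instance : Module k (WordModule k m n) := inferInstanceAs (Module k ((Fin n → Fin m) → k))

instance : Module (MonoidAlgebra k (Equiv.Perm (Fin n))) (WordModule k m n) :=
  inferInstanceAs (Module _ (wordRep k m n).asModule)

instance : IsScalarTower k (MonoidAlgebra k (Equiv.Perm (Fin n))) (WordModule k m n) :=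
  inferInstanceAs (IsScalarTower k _ (wordRep k m n).asModule)

/-- The commutant of `S_n` acting on functions on words (a Schur algebra). -/
abbrev SchurAlgebra (k : Type u) [Field k] (m n : ℕ) : Type u :=
  Module.End (MonoidAlgebra k (Equiv.Perm (Fin n))) (WordModule k m n)

/-- A matrix indexed by words which is invariant under permutations of the letters. -/
def IsLetterInvariant (M : Matrix (Fin n → Fin m) (Fin n → Fin m) k) : Prop :=
  ∀ (σ : Equiv.Perm (Fin n)) w w', M (w ∘ σ) (w' ∘ σ) = M w w'

theorem isLetterInvariant_tensorPowMatrix (g : Matrix (Fin m) (Fin m) k) :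
    IsLetterInvariant (tensorPowMatrix n g) := fun σ w w' =>
  Equiv.prod_comp σ fun t => g (w t) (w' t)

/-- The element of the Schur algebra given by an invariant matrix. -/
def IsLetterInvariant.toSchur {M : Matrix (Fin n → Fin m) (Fin n → Fin m) k}
    (hM : IsLetterInvariant M) : SchurAlgebra k m n :=
  Representation.IntertwiningMap.equivLinearMapAsModule _ _ <|
    LinearMap.intertwiningMap_of_isIntertwiningMap _ _ M.mulVecLin fun σ x => by
      ext w
      change ∑ w', M w w' * x (w' ∘ σ) = ∑ w', M (w ∘ σ) w' * x w'
      exact (Finset.sum_congr rfl fun w' _ => congrArg (· * x (w' ∘ σ)) (hM σ w w').symm).trans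
        (Equiv.sum_comp (Equiv.arrowCongr σ.symm (Equiv.refl (Fin m)))
          fun w' => M (w ∘ σ) w' * x w')

/-- The matrix of an element of the Schur algebra. -/
def schurMatrix : SchurAlgebra k m n →ₗ[k] Matrix (Fin n → Fin m) (Fin n → Fin m) k where
  toFun a := LinearMap.toMatrix'
    (show ((Fin n → Fin m) → k) →ₗ[k] ((Fin n → Fin m) → k) from a.restrictScalars k)
  map_add' _ _ := rfl
  map_smul' _ _ := rfl

theorem schurMatrix_mulVec (a : SchurAlgebra k m n) (x : WordModule k m n) :
    schurMatrix a *ᵥ x = a x :=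
  LinearMap.toMatrix'_mulVec
    (show ((Fin n → Fin m) → k) →ₗ[k] ((Fin n → Fin m) → k) from a.restrictScalars k) x

theorem schurMatrix_injective : Function.Injective (schurMatrix (k := k) (m := m) (n := n)) := by
  intro a b h
  refine LinearMap.ext fun x => ?_
  exact (schurMatrix_mulVec a x).symm.trans ((congrArg (· *ᵥ x) h).trans (schurMatrix_mulVec b x))

theorem schurMatrix_toSchur {M : Matrix (Fin n → Fin m) (Fin n → Fin m) k}
    (hM : IsLetterInvariant M) : schurMatrix hM.toSchur = M :=
  Matrix.mulVec_injective <| funext fun x => schurMatrix_mulVec hM.toSchur x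

theorem isLetterInvariant_schurMatrix (a : SchurAlgebra k m n) :
    IsLetterInvariant (schurMatrix a) := by
  intro σ w w'
  have h := ((Representation.IntertwiningMap.equivLinearMapAsModule (wordRep k m n)
    (wordRep k m n)).symm a).isIntertwining _ _ σ (Pi.single (w' ∘ σ) 1)
  have h1 : wordRep k m n σ (Pi.single (w' ∘ σ) 1) = Pi.single w' 1 := by
    ext u
    change (Pi.single (w' ∘ σ) 1 : (Fin n → Fin m) → k) (u ∘ σ) = _
    simp [Pi.single_apply, σ.surjective.injective_comp_right.eq_iff]
  rw [h1] at h
  have h2 : (schurMatrix a *ᵥ Pi.single w' 1) w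
    = (schurMatrix a *ᵥ Pi.single (w' ∘ σ) 1) (w ∘ σ) :=
    (congrFun (schurMatrix_mulVec a _) w).trans
      ((congrFun h w).trans (congrFun (schurMatrix_mulVec a _) (w ∘ σ)).symm)
  simpa using h2.symm

end Words

section Content

/-- The number of occurrences of each letter in a word. -/
def content {α : Type*} {n : ℕ} (f : Fin n → α) : α →₀ ℕ := ∑ t, Finsupp.single (f t) 1

variable {α : Type*} {n : ℕ}

theorem content_apply [DecidableEq α] (f : Fin n → α) (a : α) :
    content f a = (Finset.univ.filter fun t => f t = a).card := by
  simp [content, Finsupp.finsetSum_apply, Finsupp.single_apply]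

theorem content_comp (f : Fin n → α) (σ : Equiv.Perm (Fin n)) : content (f ∘ σ) = content f :=
  Equiv.sum_comp σ fun t => Finsupp.single (f t) 1

theorem exists_comp_eq_of_content_eq {f g : Fin n → α} (h : content f = content g) :
    ∃ σ : Equiv.Perm (Fin n), f ∘ σ = g := by
  classical
  have e (a : α) : Nonempty ({t // g t = a} ≃ {t // f t = a}) := by
    refine ⟨Fintype.equivOfCardEq ?_⟩
    simpa only [Fintype.card_subtype, content_apply] using DFunLike.congr_fun h.symm a
  exact ⟨Equiv.ofFiberEquiv fun a => (e a).some, funext fun t => Equiv.ofFiberEquiv_map _ t⟩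

theorem sum_content [Fintype α] (f : Fin n → α) : ∑ a, content f a = n := by
  classical
  simp only [content_apply]
  exact (Finset.card_eq_sum_card_fiberwise fun _ _ => Finset.mem_coe.2
    (Finset.mem_univ _)).symm.trans (by simp)

theorem content_le (f : Fin n → α) (a : α) : content f a ≤ n := by
  classical
  rw [content_apply]
  exact (Finset.card_le_univ _).trans_eq (Fintype.card_fin n)

@[to_additive]
theorem prod_comp_eq_prod_pow_content [Fintype α] {M : Type*} [CommMonoid M] (f : α → M)
    (w : Fin n → α) : ∏ t, f (w t) = ∏ a, f a ^ content w a := by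
  classical
  simp only [content_apply, Finset.card_filter, ← Finset.prod_pow_eq_pow_sum, pow_ite, pow_one,
    pow_zero]
  rw [Finset.prod_comm]
  simp

theorem prod_X_eq_monomial_content {R : Type*} [CommSemiring R] (f : Fin n → α) :
    ∏ t, (MvPolynomial.X (f t) : MvPolynomial α R) = MvPolynomial.monomial (content f) 1 :=
  (MvPolynomial.monomial_sum_one _ _).symm

end Content

section Span

open Matrix

variable {k : Type u} {m n : ℕ}

theorem IsLetterInvariant.eq_of_content_eq {M : Matrix (Fin n → Fin m) (Fin n → Fin m) k}
    (hM : IsLetterInvariant M) {p q : Fin n → Fin m × Fin m} (h : content p = content q) :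
    M (fun t => (p t).1) (fun t => (p t).2) = M (fun t => (q t).1) (fun t => (q t).2) := by
  obtain ⟨σ, rfl⟩ := exists_comp_eq_of_content_eq h
  exact (hM σ _ _).symm

variable [Field k]

theorem tensorPowMatrix_smul (c : k) (g : Matrix (Fin m) (Fin m) k) :
    tensorPowMatrix n (c • g) = c ^ n • tensorPowMatrix n g := by
  ext w w'
  simp [tensorPowMatrix, Finset.prod_mul_distrib]

/-- A linear form in the coefficients of the `n`-th tensor power of a matrix that vanishes on
`SL_m` vanishes identically. -/
theorem eq_zero_of_eval_specialLinearGroup [IsAlgClosed k] (hm : 0 < m)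
    (f : Matrix (Fin n → Fin m) (Fin n → Fin m) k →ₗ[k] k)
    (hf : ∀ g : SpecialLinearGroup (Fin m) k, f (tensorPowMatrix n (g : Matrix _ _ k)) = 0)
    (g : Matrix (Fin m) (Fin m) k) (hg : g.det ≠ 0) : f (tensorPowMatrix n g) = 0 := by
  obtain ⟨c, hc⟩ := IsAlgClosed.exists_pow_nat_eq g.det hm
  have hc0 : c ≠ 0 := fun h => hg (by rw [← hc, h, zero_pow hm.ne'])
  have hdet : (c⁻¹ • g).det = 1 := by
    rw [det_smul, Fintype.card_fin, ← hc, inv_pow, inv_mul_cancel₀ (pow_ne_zero _ hc0)]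
  have h := hf ⟨_, hdet⟩
  rw [tensorPowMatrix_smul, map_smul, smul_eq_mul] at h
  exact (mul_eq_zero.mp h).resolve_left (pow_ne_zero _ (inv_ne_zero hc0))

/-- The invariant matrices are spanned by the tensor powers of the elements of `SL_m`. -/
theorem IsLetterInvariant.mem_span [IsAlgClosed k] (hm : 0 < m)
    {M : Matrix (Fin n → Fin m) (Fin n → Fin m) k} (hM : IsLetterInvariant M) :
    M ∈ Submodule.span k (Set.range fun g : SpecialLinearGroup (Fin m) k =>
      tensorPowMatrix n (g : Matrix (Fin m) (Fin m) k)) := by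
  by_contra hMs
  obtain ⟨f, hfM, hf⟩ := Submodule.exists_le_ker_of_notMem hMs
  have hf (g : SpecialLinearGroup (Fin m) k) : f (tensorPowMatrix n (g : Matrix _ _ k)) = 0 :=
    hf (Submodule.subset_span ⟨g, rfl⟩)
  let c (p : Fin n → Fin m × Fin m) : k :=
    f (Matrix.single (fun t => (p t).1) (fun t => (p t).2) 1)
  have hfc (B : Matrix (Fin n → Fin m) (Fin n → Fin m) k) :
      f B = ∑ p, c p * B (fun t => (p t).1) (fun t => (p t).2) := by
    conv_lhs => rw [matrix_eq_sum_single B]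
    simp only [map_sum]
    rw [← Fintype.sum_prod_type', ← (Equiv.arrowProdEquivProdArrow (Fin n) (fun _ => Fin m)
      (fun _ => Fin m)).sum_comp]
    refine Finset.sum_congr rfl fun p _ => ?_
    have h (w w' : Fin n → Fin m) (b : k) : f (Matrix.single w w' b) =
        f (Matrix.single w w' 1) * b := by
      rw [mul_comm, ← smul_eq_mul, ← map_smul, smul_single, smul_eq_mul, mul_one]
    exact h _ _ _
  let P : MvPolynomial (Fin m × Fin m) k :=
    ∑ p : Fin n → Fin m × Fin m, MvPolynomial.C (c p) * ∏ t, MvPolynomial.X (p t)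
  have hP (x) : MvPolynomial.eval x P = f (tensorPowMatrix n (Matrix.of (Function.curry x))) := by
    simp [P, hfc, tensorPowMatrix, Function.curry]
  have hP0 : P = 0 := by
    refine (mul_eq_zero.mp (?_ : P * (mvPolynomialX (Fin m) (Fin m) k).det = 0)).resolve_right
      (det_mvPolynomialX_ne_zero _ _)
    refine MvPolynomial.funext fun x => ?_
    have hdet : MvPolynomial.eval x (mvPolynomialX (Fin m) (Fin m) k).det =
        (Matrix.of (Function.curry x)).det := by
      rw [RingHom.map_det]
      congr 1
      ext i j
      simp [Function.curry]
    rw [map_mul, map_zero, hP, hdet, mul_eq_zero, or_iff_not_imp_right]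
    exact eq_zero_of_eval_specialLinearGroup hm f hf _
  have hcoeff (d : Fin m × Fin m →₀ ℕ) :
      ∑ p : Fin n → Fin m × Fin m with content p = d, c p = 0 := by
    have h := congrArg (MvPolynomial.coeff d) hP0
    simpa [P, MvPolynomial.coeff_sum, prod_X_eq_monomial_content, MvPolynomial.coeff_C_mul,
      MvPolynomial.coeff_monomial, Finset.sum_filter] using h
  refine hfM ?_
  rw [hfc, ← Finset.sum_fiberwise_of_maps_to (s := Finset.univ)
    (t := Finset.univ.image (content (α := Fin m × Fin m) (n := n))) (g := content)
    fun p _ => Finset.mem_image_of_mem _ (Finset.mem_univ p)]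
  refine Finset.sum_eq_zero fun d hd => ?_
  obtain ⟨q, -, rfl⟩ := Finset.mem_image.mp hd
  rw [Finset.sum_congr rfl fun p hp => congrArg (c p * ·)
    (hM.eq_of_content_eq (Finset.mem_filter.mp hp).2), ← Finset.sum_mul, hcoeff, zero_mul]

theorem finrank_schurAlgebra_le (hm : 0 < m) :
    Module.finrank k (SchurAlgebra k m n) ≤ (n + 1) ^ (m * m) := by
  have : NeZero m := ⟨hm.ne'⟩
  let r (d : Fin m × Fin m → Fin (n + 1)) : Fin n → Fin m × Fin m :=
    Function.invFun (fun p a => (⟨content p a, Nat.lt_succ_of_le (content_le p a)⟩ : Fin (n + 1))) d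
  let F : SchurAlgebra k m n →ₗ[k] ((Fin m × Fin m → Fin (n + 1)) → k) :=
    { toFun a d := schurMatrix a (fun t => (r d t).1) (fun t => (r d t).2)
      map_add' a b := by
        ext d
        rw [map_add]
        rfl
      map_smul' c a := by
        ext d
        rw [map_smul]
        rfl }
  have hF : Function.Injective F := by
    intro a b hab
    refine schurMatrix_injective ?_
    ext w w'
    let p (t : Fin n) := (w t, w' t)
    let d (i) : Fin (n + 1) := ⟨content p i, Nat.lt_succ_of_le (content_le p i)⟩
    have hd : content (r d) = content p := by
      ext i
      exact congrArg Fin.val (congrFun (Function.invFun_eq (f := fun p a =>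
        (⟨content p a, Nat.lt_succ_of_le (content_le p a)⟩ : Fin (n + 1))) ⟨p, rfl⟩) i)
    exact ((isLetterInvariant_schurMatrix a).eq_of_content_eq hd).symm.trans
      ((congrFun hab d).trans ((isLetterInvariant_schurMatrix b).eq_of_content_eq hd))
  simpa using LinearMap.finrank_le_finrank_of_injective hF

end Span

section HighestWeight

open Matrix

variable {k : Type u} [Field k] {m n : ℕ}

theorem IsLetterInvariant.mulVec_mem {M : Matrix (Fin n → Fin m) (Fin n → Fin m) k}
    (hM : IsLetterInvariant M) {T : Submodule (SchurAlgebra k m n) (WordModule k m n)}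
    {v : (Fin n → Fin m) → k} (hv : v ∈ T) : M *ᵥ v ∈ T :=
  T.smul_mem hM.toSchur hv

/-- The sum of the letters of a word. -/
def level (w : Fin n → Fin m) : ℕ := ∑ t, (w t : ℕ)

theorem level_eq_of_content_eq {w w' : Fin n → Fin m} (h : content w = content w') :
    level w = level w' := by
  obtain ⟨σ, rfl⟩ := exists_comp_eq_of_content_eq h
  exact (Equiv.sum_comp σ fun t => (w t : ℕ)).symm

theorem level_swap_comp_lt {w : Fin n → Fin m} {i j : Fin m} (hij : i < j)
    (h : content w i < content w j) : level (Equiv.swap i j ∘ w) < level w := by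
  zify [level]
  simp only [Function.comp_apply]
  rw [sum_comp_eq_sum_nsmul_content (fun a => ((Equiv.swap i j a : Fin m) : ℤ)) w,
    sum_comp_eq_sum_nsmul_content (fun a => ((a : Fin m) : ℤ)) w, ← sub_pos,
    ← Finset.sum_sub_distrib, Finset.sum_eq_add i j hij.ne]
  · simp only [Equiv.swap_apply_left, Equiv.swap_apply_right, nsmul_eq_mul]
    have h1 : ((i : ℕ) : ℤ) < (j : ℕ) := by exact_mod_cast hij
    have h2 : (content w i : ℤ) < content w j := by exact_mod_cast h
    nlinarith
  · rintro a - ⟨hi, hj⟩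
    rw [Equiv.swap_apply_of_ne_of_ne hi hj, sub_self]
  · simp
  · simp

theorem isLetterInvariant_diagonal_content (d : Fin m →₀ ℕ) :
    IsLetterInvariant
      (Matrix.diagonal fun w : Fin n → Fin m => if content w = d then (1 : k) else 0) := by
  intro σ w w'
  simp [Matrix.diagonal_apply, content_comp, σ.surjective.injective_comp_right.eq_iff]

theorem isLetterInvariant_letterPerm (s : Equiv.Perm (Fin m)) :
    IsLetterInvariant
      (Matrix.of fun w w' : Fin n → Fin m => if s ∘ w = w' then (1 : k) else 0) := by
  intro σ w w'
  simp [← Function.comp_assoc, σ.surjective.injective_comp_right.eq_iff]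

/-- Every nonzero submodule over the Schur algebra contains a highest weight vector. -/
theorem exists_highest_weight {T : Submodule (SchurAlgebra k m n) (WordModule k m n)}
    (hT : T ≠ ⊥) :
    ∃ w₀ : Fin n → Fin m, Antitone (content w₀) ∧ ∃ v : (Fin n → Fin m) → k, v ∈ T ∧ v ≠ 0 ∧
      (∀ w, content w ≠ content w₀ → v w = 0) ∧
      ∀ g : Matrix (Fin m) (Fin m) k, (∀ i, g i i = 1) → (∀ i j, j < i → g i j = 0) →
        tensorPowMatrix n g *ᵥ v = v := by
  classical
  let S : Set (Fin n → Fin m) := {w | ∃ u : (Fin n → Fin m) → k, u ∈ T ∧ u w ≠ 0}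
  have hS : S.Nonempty := by
    obtain ⟨u, hu, hu0⟩ := T.ne_bot_iff.mp hT
    obtain ⟨w, hw⟩ := Function.ne_iff.mp (show (u : (Fin n → Fin m) → k) ≠ 0 from hu0)
    exact ⟨w, u, hu, hw⟩
  obtain ⟨w₀, ⟨u, hu, hu0⟩, hmin⟩ := S.toFinite.exists_minimalFor level S hS
  have hmin (x : (Fin n → Fin m) → k) (hx : x ∈ T) (w) (hw : level w < level w₀) : x w = 0 := by
    by_contra hxw
    exact hw.not_ge (hmin ⟨x, hx, hxw⟩ hw.le)
  refine ⟨w₀, ?_, _, (isLetterInvariant_diagonal_content (content w₀)).mulVec_mem hu, ?_, ?_, ?_⟩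
  · intro i j hij
    by_contra! h
    have hij := lt_of_le_of_ne hij fun h' => (h' ▸ h).false
    refine hu0 ?_
    have h1 := hmin _ ((isLetterInvariant_letterPerm (Equiv.swap i j)).mulVec_mem hu) _
      (level_swap_comp_lt hij h)
    have h2 : Equiv.swap i j ∘ Equiv.swap i j ∘ w₀ = w₀ := by
      ext t
      simp
    simpa [mulVec, dotProduct, h2] using h1
  · intro h
    refine hu0 ?_
    simpa [mulVec_diagonal] using congrFun h w₀
  · intro w hw
    simp [mulVec_diagonal, hw]
  · intro g hg1 hg0
    set v := Matrix.diagonal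
      (fun w : Fin n → Fin m => if content w = content w₀ then (1 : k) else 0)
      *ᵥ u with hv
    have hvT : v ∈ T := (isLetterInvariant_diagonal_content (content w₀)).mulVec_mem hu
    have hvw (w) (hw : v w ≠ 0) : level w = level w₀ := by
      refine level_eq_of_content_eq ?_
      by_contra h
      simp [hv, mulVec_diagonal, h] at hw
    have hlow (w w' : Fin n → Fin m) (h : tensorPowMatrix n g w w' ≠ 0) : ∀ t, w t ≤ w' t := by
      intro t
      by_contra! ht
      exact h (Finset.prod_eq_zero (Finset.mem_univ t) (hg0 _ _ ht))
    ext w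
    rcases lt_or_ge (level w) (level w₀) with hw | hw
    · rw [hmin _ ((isLetterInvariant_tensorPowMatrix g).mulVec_mem hvT) w hw, hmin _ hvT w hw]
    · rw [mulVec, dotProduct, Finset.sum_eq_single w]
      · simp [tensorPowMatrix, hg1]
      · intro w' _ hne
        by_contra h
        rw [mul_eq_zero, not_or] at h
        have hle := hlow _ _ h.1
        have hlev : level w = level w' :=
          le_antisymm (Finset.sum_le_sum fun t _ => hle t) ((hvw w' h.2).trans_le hw)
        have heq := (Finset.sum_eq_sum_iff_of_le fun t _ => Fin.val_fin_le.mpr (hle t)).mp hlev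
        exact hne (funext fun t => Fin.ext (heq t (Finset.mem_univ t)).symm)
      · simp

theorem tensorPowMatrix_mulVec_of_isDiag {d : Fin m →₀ ℕ} {v : (Fin n → Fin m) → k}
    (hv : ∀ w, content w ≠ d → v w = 0) {g : Matrix (Fin m) (Fin m) k} (hg : g.IsDiag) :
    tensorPowMatrix n g *ᵥ v = (∏ i, g i i ^ d i) • v := by
  ext w
  rw [mulVec, dotProduct, Finset.sum_eq_single w]
  · by_cases h : content w = d
    · rw [Pi.smul_apply, smul_eq_mul, ← h,
        ← prod_comp_eq_prod_pow_content (fun i => g i i) w]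
      rfl
    · simp [hv w h]
  · intro w' _ hne
    obtain ⟨t, ht⟩ := Function.ne_iff.mp hne
    rw [tensorPowMatrix, of_apply, Finset.prod_eq_zero (Finset.mem_univ t) (hg ht.symm), zero_mul]
  · simp

end HighestWeight

section Concentration

open Filter Topology

variable {m n : ℕ}

/-- The Chernoff bound for sums of independent uniformly distributed letters. -/
theorem card_le_sum_le (c : Fin m → ℝ) (hc0 : ∑ a, c a = 0) (hc1 : ∀ a, |c a| ≤ 1) {s : ℝ}
    (hs0 : 0 ≤ s) (hs1 : s ≤ 1) (L : ℝ) :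
    ((Finset.univ.filter fun w : Fin n → Fin m => L ≤ ∑ t, c (w t)).card : ℝ)
      ≤ (m : ℝ) ^ n * Real.exp (n * s ^ 2 - s * L) := by
  have h1 (a : Fin m) : Real.exp (s * c a) ≤ 1 + s * c a + s ^ 2 := by
    have hsc : |s * c a| ≤ s := by
      rw [abs_mul, abs_of_nonneg hs0]
      exact mul_le_of_le_one_right hs0 (hc1 a)
    have h := (abs_le.mp (Real.abs_exp_sub_one_sub_id_le (hsc.trans hs1))).2
    have h' : (s * c a) ^ 2 ≤ s ^ 2 := sq_le_sq' (by linarith [abs_le.mp hsc]) (abs_le.mp hsc).2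
    linarith
  have h2 : ∑ a, Real.exp (s * c a) ≤ m * Real.exp (s ^ 2) := by
    refine (Finset.sum_le_sum fun a _ => h1 a).trans ?_
    rw [Finset.sum_add_distrib, Finset.sum_add_distrib, ← Finset.mul_sum, hc0]
    simp only [Finset.sum_const, Finset.card_univ, Fintype.card_fin, nsmul_eq_mul]
    nlinarith [Real.add_one_le_exp (s ^ 2), Nat.cast_nonneg (α := ℝ) m]
  have h3 : ∑ w : Fin n → Fin m, Real.exp (s * ∑ t, c (w t)) ≤ (m * Real.exp (s ^ 2)) ^ n := by
    refine le_trans (le_of_eq ?_)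
      (pow_le_pow_left₀ (Finset.sum_nonneg fun a _ => (Real.exp_pos _).le) h2 n)
    rw [← Fintype.piFinset_univ, Finset.sum_pow']
    simp only [Finset.mul_sum, Real.exp_sum]
  have h4 : ((Finset.univ.filter fun w : Fin n → Fin m => L ≤ ∑ t, c (w t)).card : ℝ)
      * Real.exp (s * L) ≤ (m * Real.exp (s ^ 2)) ^ n := by
    refine le_trans ?_ h3
    rw [← nsmul_eq_mul, ← Finset.sum_const, Finset.sum_filter]
    refine Finset.sum_le_sum fun w _ => ?_
    split_ifs with hw
    · exact Real.exp_le_exp.mpr (mul_le_mul_of_nonneg_left hw hs0)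
    · exact (Real.exp_pos _).le
  refine ((le_div_iff₀ (Real.exp_pos _)).mpr h4).trans_eq ?_
  rw [Real.exp_sub, Real.exp_nat_mul, mul_pow, mul_div_assoc]

/-- The words of length `n` some letter of which occurs with a frequency far from the mean. -/
def unbalancedWords (m n : ℕ) : Finset (Fin n → Fin m) :=
  {w | ∃ i, (n : ℝ) ^ ((2 : ℝ) / 3) ≤ |(content w i : ℝ) - n / m|}

theorem card_unbalancedWords_le (hm : 0 < m) (hn : 0 < n) :
    ((unbalancedWords m n).card : ℝ)
      ≤ 2 * m * (m : ℝ) ^ n * Real.exp (-((n : ℝ) ^ ((1 : ℝ) / 3) / 4)) := by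
  set x := (n : ℝ) ^ ((1 : ℝ) / 3) with hx
  have hn1 : (1 : ℝ) ≤ n := by exact_mod_cast hn
  have hm1 : (1 : ℝ) ≤ m := by exact_mod_cast hm
  have hx1 : 1 ≤ x := Real.one_le_rpow hn1 (by norm_num)
  have hx2 : (n : ℝ) ^ ((2 : ℝ) / 3) = x ^ 2 := by
    rw [hx, ← Real.rpow_natCast, ← Real.rpow_mul (by positivity)]
    norm_num
  have hx3 : (n : ℝ) = x ^ 3 := by
    rw [hx, ← Real.rpow_natCast, ← Real.rpow_mul (by positivity)]
    norm_num
  let c (i a : Fin m) : ℝ := (if a = i then 1 else 0) - 1 / m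
  have hc0 (i) : ∑ a, c i a = 0 := by
    simp [c, Finset.sum_sub_distrib, (zero_lt_one.trans_le hm1).ne']
  have hc1 (i a) : |c i a| ≤ 1 := by
    have h1 : 1 / (m : ℝ) ≤ 1 := by
      rw [div_le_one (by positivity)]
      exact hm1
    have h0 : 0 < 1 / (m : ℝ) := by positivity
    rw [abs_le]
    dsimp only [c]
    split_ifs <;> constructor <;> linarith
  have hc (i) (w : Fin n → Fin m) : (content w i : ℝ) - n / m = ∑ t, c i (w t) := by
    simp only [c, Finset.sum_sub_distrib, Finset.sum_boole, content_apply]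
    simp [div_eq_mul_inv]
  have key (e : Fin m → ℝ) (he0 : ∑ a, e a = 0) (he1 : ∀ a, |e a| ≤ 1) :
      ((Finset.univ.filter fun w : Fin n → Fin m => x ^ 2 ≤ ∑ t, e (w t)).card : ℝ)
        ≤ (m : ℝ) ^ n * Real.exp (-(x / 4)) := by
    have hs : 1 / (2 * x) ≤ 1 := by
      rw [div_le_one (by positivity)]
      linarith
    refine (card_le_sum_le e he0 he1 (by positivity) hs (x ^ 2)).trans_eq ?_
    rw [hx3]
    congr 2
    field_simp
    ring
  have hsub : unbalancedWords m n ⊆ Finset.univ.biUnion fun i =>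
      (Finset.univ.filter fun w : Fin n → Fin m => x ^ 2 ≤ ∑ t, c i (w t)) ∪
      (Finset.univ.filter fun w : Fin n → Fin m => x ^ 2 ≤ ∑ t, (-c i) (w t)) := by
    intro w hw
    obtain ⟨i, hi⟩ := (Finset.mem_filter.mp hw).2
    rw [hx2, hc, le_abs] at hi
    simpa using ⟨i, hi⟩
  calc ((unbalancedWords m n).card : ℝ)
      ≤ ∑ i : Fin m,
        (((Finset.univ.filter fun w : Fin n → Fin m => x ^ 2 ≤ ∑ t, c i (w t)).card : ℝ)
        + ((Finset.univ.filter fun w : Fin n → Fin m => x ^ 2 ≤ ∑ t, (-c i) (w t)).card : ℝ)) := by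
        exact_mod_cast (Finset.card_le_card hsub).trans (Finset.card_biUnion_le.trans
          (Finset.sum_le_sum fun i _ => Finset.card_union_le _ _))
    _ ≤ ∑ i : Fin m, ((m : ℝ) ^ n * Real.exp (-(x / 4)) + (m : ℝ) ^ n * Real.exp (-(x / 4))) :=
        Finset.sum_le_sum fun i _ => add_le_add (key _ (hc0 i) (hc1 i))
          (key _ (by simp [hc0]) (by simpa using hc1 i))
    _ = _ := by
        simp only [Finset.sum_const, Finset.card_univ, Fintype.card_fin, nsmul_eq_mul]
        ring

theorem eventually_card_unbalancedWords_le (hm : 0 < m) (M : ℕ) :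
    ∀ᶠ n : ℕ in atTop, 2 * ((n + 1) ^ M * (unbalancedWords m n).card) ≤ m ^ n := by
  have h1 : Tendsto (fun n : ℕ => (n : ℝ) ^ ((1 : ℝ) / 3) / 4) atTop atTop :=
    ((tendsto_rpow_atTop (by norm_num)).comp tendsto_natCast_atTop_atTop).atTop_div_const
      (by norm_num)
  have h2 := ((Real.tendsto_pow_mul_exp_neg_atTop_nhds_zero (3 * M)).comp h1).const_mul
    (4 * m * 128 ^ M : ℝ)
  rw [mul_zero] at h2
  filter_upwards [h2.eventually_le_const one_pos, eventually_gt_atTop 0] with n hn hn0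
  have hn1 : (1 : ℝ) ≤ n := by exact_mod_cast hn0
  set y := (n : ℝ) ^ ((1 : ℝ) / 3) / 4 with hy
  have hy3 : (n : ℝ) = 64 * y ^ 3 := by
    rw [hy, div_pow, ← Real.rpow_natCast, ← Real.rpow_mul (by positivity)]
    norm_num
    ring
  have h3 : ((n : ℝ) + 1) ^ M ≤ 128 ^ M * y ^ (3 * M) := by
    rw [pow_mul, ← mul_pow]
    exact pow_le_pow_left₀ (by positivity) (by linarith) M
  have h4 : 2 * (((n : ℝ) + 1) ^ M * (unbalancedWords m n).card) ≤ (m : ℝ) ^ n := by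
    calc 2 * (((n : ℝ) + 1) ^ M * (unbalancedWords m n).card)
        ≤ 2 * ((128 ^ M * y ^ (3 * M)) * (2 * m * (m : ℝ) ^ n * Real.exp (-y))) :=
          mul_le_mul_of_nonneg_left (mul_le_mul h3 (card_unbalancedWords_le hm hn0)
            (Nat.cast_nonneg _) (by positivity)) (by norm_num)
      _ = (m : ℝ) ^ n * (4 * m * 128 ^ M * (y ^ (3 * M) * Real.exp (-y))) := by ring
      _ ≤ (m : ℝ) ^ n * 1 := mul_le_mul_of_nonneg_left hn (by positivity)
      _ = _ := mul_one _
  exact_mod_cast h4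

end Concentration

section SchurRep

open Matrix

variable {k : Type u} [Field k] {m n : ℕ}

/-- The homomorphism from `SL_m` to the Schur algebra. -/
def specialLinearToSchur (k : Type u) [Field k] (m n : ℕ) :
    SpecialLinearGroup (Fin m) k →* SchurAlgebra k m n where
  toFun g := (isLetterInvariant_tensorPowMatrix (g : Matrix (Fin m) (Fin m) k)).toSchur
  map_one' := schurMatrix_injective <| by
    exact (schurMatrix_toSchur _).trans (tensorPowMatrix_one.trans LinearMap.toMatrix'_id.symm)
  map_mul' g h := LinearMap.ext fun x =>
    (congrArg (· *ᵥ x) (tensorPowMatrix_mul (g : Matrix (Fin m) (Fin m) k) h)).trans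
      (mulVec_mulVec _ _ _).symm

theorem span_range_specialLinearToSchur [IsAlgClosed k] (hm : 0 < m) :
    Submodule.span k (Set.range (specialLinearToSchur k m n)) = ⊤ := by
  refine eq_top_iff.mpr fun a _ => ?_
  have h := (isLetterInvariant_schurMatrix a).mem_span hm
  have hr : (Set.range fun g : SpecialLinearGroup (Fin m) k =>
      tensorPowMatrix n (g : Matrix (Fin m) (Fin m) k)) =
      schurMatrix '' Set.range (specialLinearToSchur k m n) := by
    rw [← Set.range_comp]
    exact congrArg Set.range (funext fun g =>
      (schurMatrix_toSchur (isLetterInvariant_tensorPowMatrix g.1)).symm)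
  rw [hr, ← Submodule.map_span] at h
  obtain ⟨b, hb, hab⟩ := h
  rwa [← schurMatrix_injective hab]

/-- The representation of `SL_m` underlying a module over the Schur algebra. -/
def schurRep (k : Type u) [Field k] (m n : ℕ) (Y : Type*) [AddCommGroup Y] [Module k Y]
    [Module (SchurAlgebra k m n) Y] [IsScalarTower k (SchurAlgebra k m n) Y] :
    Representation k (SpecialLinearGroup (Fin m) k) Y :=
  (Algebra.lsmul k k Y).toMonoidHom.comp (specialLinearToSchur k m n)

variable {Y Z : Type u} [AddCommGroup Y] [Module k Y] [Module (SchurAlgebra k m n) Y]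
  [IsScalarTower k (SchurAlgebra k m n) Y]
  [AddCommGroup Z] [Module k Z] [Module (SchurAlgebra k m n) Z]
  [IsScalarTower k (SchurAlgebra k m n) Z]

/-- Linear maps over the Schur algebra are morphisms of representations. -/
def schurRepHom (f : Y →ₗ[SchurAlgebra k m n] Z) :
    Rep.of (schurRep k m n Y) ⟶ Rep.of (schurRep k m n Z) :=
  Rep.ofHom <| (f.restrictScalars k).intertwiningMap_of_isIntertwiningMap _ _ fun _ y =>
    f.map_smul _ y

theorem isIrreducibleRep_schurRep [IsAlgClosed k] (hm : 0 < m)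
    [IsSimpleModule (SchurAlgebra k m n) Y] : IsIrreducibleRep (schurRep k m n Y) := by
  have := IsSimpleModule.nontrivial (SchurAlgebra k m n) Y
  refine ⟨exists_ne 0, fun U hU => ?_⟩
  have hU' (a : SchurAlgebra k m n) : ∀ y ∈ U, a • y ∈ U := by
    have ha : a ∈ Submodule.span k (Set.range (specialLinearToSchur k m n)) := by
      rw [span_range_specialLinearToSchur hm]
      exact Submodule.mem_top
    induction ha using Submodule.span_induction with
    | mem a ha =>
      obtain ⟨g, rfl⟩ := ha
      exact hU g
    | zero =>
      intro y _
      rw [zero_smul]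
      exact U.zero_mem
    | add a b _ _ ha hb =>
      intro y hy
      rw [add_smul]
      exact U.add_mem (ha y hy) (hb y hy)
    | smul c a _ ha =>
      intro y hy
      rw [smul_assoc]
      exact U.smul_mem c (ha y hy)
  let U' : Submodule (SchurAlgebra k m n) Y :=
    { U.toAddSubmonoid with smul_mem' := fun a y hy => hU' a y hy }
  have := (isSimpleModule_iff (SchurAlgebra k m n) Y).mp ‹_›
  refine (this.eq_bot_or_eq_top U').imp (fun h => ?_) fun h => ?_
  · exact SetLike.coe_injective
      (congrArg (fun V : Submodule (SchurAlgebra k m n) Y => (V : Set Y)) h)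
  · exact SetLike.coe_injective
      (congrArg (fun V : Submodule (SchurAlgebra k m n) Y => (V : Set Y)) h)

theorem nonempty_iso_tpow (k : Type u) [Field k] (m n : ℕ) :
    Nonempty (Rep.of (schurRep k m n (WordModule k m n)) ≅ tpow (natRepSL k m) n) := by
  obtain ⟨e, he⟩ := exists_tpow_linearEquiv (k := k) (m := m) n
  let f : Rep.of (schurRep k m n (WordModule k m n)) ⟶ tpow (natRepSL k m) n :=
    Rep.ofHom <| e.symm.toLinearMap.intertwiningMap_of_isIntertwiningMap _ _ fun g x => by
      refine e.symm_apply_eq.mpr ((he g _).trans ?_).symm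
      rw [LinearEquiv.coe_coe, LinearEquiv.apply_symm_apply]
      rfl
  let f' : tpow (natRepSL k m) n ⟶ Rep.of (schurRep k m n (WordModule k m n)) :=
    Rep.ofHom <| e.toLinearMap.intertwiningMap_of_isIntertwiningMap _ _ he
  exact ⟨⟨f, f', Rep.hom_ext (Representation.IntertwiningMap.ext
    (LinearMap.ext fun x => e.apply_symm_apply x)), Rep.hom_ext
      (Representation.IntertwiningMap.ext (LinearMap.ext fun x => e.symm_apply_apply x))⟩⟩

end SchurRep

section Multiplicity

open Matrix

variable {k : Type u} [Field k] {m n : ℕ}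

/-- A balanced highest weight occurs in `V^{⊗n}` with high multiplicity. -/
theorem exists_balanced_many_copies [IsAlgClosed k] [CharZero k] (hm : 0 < m) (r : ℕ)
    (hr : (n + 1) ^ (m * m) * ((unbalancedWords m n).card + (n + 1) ^ (m * m) * r) < m ^ n) :
    ∃ w₀ : Fin n → Fin m, Antitone (content w₀) ∧ w₀ ∉ unbalancedWords m n ∧
      ∃ W : Rep k (SpecialLinearGroup (Fin m) k), FiniteDimensional k W.V ∧
        RepIrreducible W ∧ HasHighestWeight W (content w₀) ∧
        r + 1 ≤ multiplicityIn W (tpow (natRepSL k m) n) := by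
  classical
  have hXfin : Module.Finite k (WordModule k m n) :=
    inferInstanceAs (Module.Finite k ((Fin n → Fin m) → k))
  have hXrank : Module.finrank k (WordModule k m n) = m ^ n := by
    rw [show Module.finrank k (WordModule k m n) = Module.finrank k ((Fin n → Fin m) → k) from rfl]
    simp
  have : Module.Finite (MonoidAlgebra k (Equiv.Perm (Fin n))) (WordModule k m n) :=
    .of_restrictScalars_finite k _ _
  have : IsSemisimpleRing (SchurAlgebra k m n) := IsSemisimpleRing.moduleEnd _ _
  have : Module.Finite k (SchurAlgebra k m n) := Module.Finite.of_injective _ schurMatrix_injective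
  let single (w : Fin n → Fin m) : WordModule k m n := (Pi.single w 1 : (Fin n → Fin m) → k)
  let E : Submodule k (WordModule k m n) :=
    Submodule.span k ((unbalancedWords m n).image single : Finset (WordModule k m n))
  have hErank : Module.finrank k E ≤ (unbalancedWords m n).card :=
    (finrank_span_finset_le_card _).trans Finset.card_image_le
  let Good (T : Submodule (SchurAlgebra k m n) (WordModule k m n)) : Prop :=
    ∃ w₀ : Fin n → Fin m, Antitone (content w₀) ∧ w₀ ∉ unbalancedWords m n ∧
      ∃ v : (Fin n → Fin m) → k, v ∈ T ∧ v ≠ 0 ∧ (∀ w, content w ≠ content w₀ → v w = 0) ∧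
      ∀ g : Matrix (Fin m) (Fin m) k, (∀ i, g i i = 1) → (∀ i j, j < i → g i j = 0) →
        tensorPowMatrix n g *ᵥ v = v
  obtain ⟨T, hT, ⟨w₀, hw₀, hbal, v, hvT, hv0, hvw, hvg⟩, inc, proj, hip⟩ :=
    exists_isSimpleModule_with_many_copies (k := k) (A := SchurAlgebra k m n) E Good
      (fun T hT hgood => by
      obtain ⟨w₀, hw₀, v, hvT, hv0, hvw, hvg⟩ := exists_highest_weight
        ((Submodule.nontrivial_iff_ne_bot).mp (IsSimpleModule.nontrivial (SchurAlgebra k m n) T))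
      refine ⟨v, hvT, ?_, hv0⟩
      have hbal : w₀ ∈ unbalancedWords m n := by
        by_contra hbal
        exact hgood ⟨w₀, hw₀, hbal, v, hvT, hv0, hvw, hvg⟩
      have hv : v = ∑ w, v w • Pi.single w (1 : k) := by
        ext w
        simp [Finset.sum_apply, Pi.single_apply]
      have hsum : ∑ w, v w • single w ∈ E := by
        refine Submodule.sum_mem _ fun w _ => ?_
        by_cases hw : content w = content w₀
        · refine Submodule.smul_mem _ _ (Submodule.subset_span
            (Finset.mem_coe.mpr (Finset.mem_image_of_mem _ ?_)))
          simpa [unbalancedWords, hw] using hbal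
        · rw [hvw w hw, zero_smul]
          exact E.zero_mem
      rw [hv]
      exact hsum) r (by
      rw [hXrank]
      refine lt_of_le_of_lt ?_ hr
      have hA := finrank_schurAlgebra_le (k := k) (n := n) hm
      gcongr)
  refine ⟨w₀, hw₀, hbal, Rep.of (schurRep k m n T),
    inferInstanceAs (Module.Finite k (T.restrictScalars k)), isIrreducibleRep_schurRep hm,
    ⟨⟨v, hvT⟩, fun h => hv0 (congrArg Subtype.val h), fun g hg1 hg0 => Subtype.ext (hvg g hg1 hg0),
      fun g hg => Subtype.ext (tensorPowMatrix_mulVec_of_isDiag hvw hg)⟩, ?_⟩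
  obtain ⟨iso⟩ := nonempty_iso_tpow k m n
  obtain ⟨e, -⟩ := exists_tpow_linearEquiv (k := k) (m := m) n
  have : FiniteDimensional k (tpow (natRepSL k m) n).V := Module.Finite.equiv e.symm
  have : Nontrivial (Rep.of (schurRep k m n T)).V :=
    IsSimpleModule.nontrivial (SchurAlgebra k m n) T
  refine le_multiplicityIn (fun j => schurRepHom (inc j) ≫ iso.hom)
    (fun i => iso.inv ≫ schurRepHom (proj i)) fun i j => ?_
  rw [Category.assoc, Iso.hom_inv_id_assoc]
  refine (Rep.hom_ext (Representation.IntertwiningMap.ext (LinearMap.ext fun x => ?_)) :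
    _ = schurRepHom (if i = j then LinearMap.id else 0)).trans (by split_ifs <;> rfl)
  exact LinearMap.congr_fun (hip i j) x

end Multiplicity

/-- **Lemma.** There are constants `C > 0`, `K` (depending only on `m`) and `N` such that
for all `n > N` there is a partition `lam` of `n` close to the mean for which the
irreducible representation `V_lam` occurs in `V^{⊗n}` with multiplicity `> C·m^n/n^K`. -/
theorem exists_close_to_mean_with_large_multiplicity {k : Type u} [Field k] [IsAlgClosed k]
    [CharZero k] {m : ℕ} (hm : 0 < m) :
    ∃ C : ℝ, 0 < C ∧ ∃ K : ℕ, ∃ N : ℕ, ∀ n : ℕ, n > N →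
      ∃ lam : Fin m → ℕ, Antitone lam ∧ (∑ i : Fin m, lam i) = n ∧
        (∀ i : Fin m, |(lam i : ℝ) - (n : ℝ) / (m : ℝ)| < (n : ℝ) ^ ((2 : ℝ) / 3)) ∧
        ∃ W : Rep k (Matrix.SpecialLinearGroup (Fin m) k), FiniteDimensional k W.V ∧
          RepIrreducible W ∧ HasHighestWeight W lam ∧
          C * (m : ℝ) ^ n / (n : ℝ) ^ K < (multiplicityIn W (tpow (natRepSL k m) n) : ℝ) := by
  obtain ⟨N, hN⟩ := Filter.eventually_atTop.mp (eventually_card_unbalancedWords_le hm (m * m))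
  refine ⟨1 / (4 * 4 ^ (m * m)), by positivity, 2 * (m * m), N, fun n hn => ?_⟩
  have hn0 : 0 < n := Nat.zero_lt_of_lt hn
  have hmn : 0 < m ^ n := pow_pos hm n
  set D := (n + 1) ^ (m * m) with hD
  have hD0 : 0 < 2 * D ^ 2 := by positivity
  set r := (m ^ n - 1) / (2 * D ^ 2)
  have hr1 : 2 * D ^ 2 * r ≤ m ^ n - 1 := Nat.mul_div_le _ _
  have hr2 : m ^ n - 1 < 2 * D ^ 2 * (r + 1) := Nat.lt_mul_div_succ _ hD0
  obtain ⟨w₀, hw₀, hbal, W, hfin, hirr, hhw, hmult⟩ := exists_balanced_many_copies (k := k) hm r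
    (n := n) (by
      have h1 := hN n hn.le
      have h2 : 2 * (D * ((unbalancedWords m n).card + D * r)) =
        2 * (D * (unbalancedWords m n).card) + 2 * D ^ 2 * r := by ring
      rw [← hD] at h1 ⊢
      omega)
  refine ⟨content w₀, hw₀, sum_content w₀, fun i => ?_, W, hfin, hirr, hhw, ?_⟩
  · by_contra! h
    exact hbal (Finset.mem_filter.mpr ⟨Finset.mem_univ _, i, h⟩)
  · have hnR : (1 : ℝ) ≤ n := by exact_mod_cast hn0
    have hDR : (D : ℝ) ^ 2 ≤ 4 ^ (m * m) * (n : ℝ) ^ (2 * (m * m)) := by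
      rw [hD, Nat.cast_pow, ← pow_mul, mul_comm (m * m), pow_mul, pow_mul (n : ℝ), ← mul_pow]
      push_cast
      exact pow_le_pow_left₀ (by positivity) (by nlinarith) _
    have hrR : (m : ℝ) ^ n ≤ 2 * D ^ 2 * (r + 1) := by
      exact_mod_cast (show m ^ n ≤ 2 * D ^ 2 * (r + 1) by omega)
    have hmR : (0 : ℝ) < (m : ℝ) ^ n := by exact_mod_cast hmn
    have hmultR : ((r : ℝ) + 1) ≤ multiplicityIn W (tpow (natRepSL k m) n) := by
      exact_mod_cast hmult
    refine lt_of_lt_of_le ?_ hmultR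
    rw [div_lt_iff₀ (by positivity), div_mul_eq_mul_div, one_mul, div_lt_iff₀ (by positivity)]
    have hr0 : (0 : ℝ) ≤ r + 1 := by positivity
    nlinarith [mul_le_mul_of_nonneg_right hDR hr0]
end
end

section
/- Let K be algebraically closed of characteristic 0 and let V be an m-dimensional vector space over K, regarded as the natural representation of SL(V). Then limsup_{n→∞} TS_{SL(V)}(V^{⊗n})^{1/n} = m, i.e. d(SL(V), V) = dim V. -/
open CategoryTheory MonoidalCategory Limits

noncomputable section

universe u

open Module

section TrivialSummands

variable {k G : Type u} [Field k] [Monoid G]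

lemma le_finrank_of_trivial_summand {V : Rep k G} [Module.Finite k V] {n : ℕ} {W : Rep k G}
    (e : V ≅ Rep.trivial k G (Fin n → k) ⊞ W) : n ≤ finrank k V := by
  let f : Rep.trivial k G (Fin n → k) ⟶ V := biprod.inl ≫ e.inv
  let g : V ⟶ Rep.trivial k G (Fin n → k) := e.hom ≫ biprod.fst
  have hfg : f ≫ g = 𝟙 _ := by simp [f, g]
  have hinj : Function.Injective f.hom.toLinearMap := by
    refine Function.LeftInverse.injective (g := g.hom) fun x => ?_
    have := congrArg (fun h : Rep.trivial k G (Fin n → k) ⟶ _ => h.hom x) hfg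
    exact this
  have := LinearMap.finrank_le_finrank_of_injective hinj
  rwa [show finrank k (Rep.trivial k G (Fin n → k)) = n from Module.finrank_fin_fun k] at this

lemma TS_le_finrank (V : Rep k G) [Module.Finite k V] : TS V ≤ finrank k V := by
  refine csSup_le' ?_
  rintro n ⟨W, ⟨e⟩⟩
  exact le_finrank_of_trivial_summand e

lemma le_TS_of_retraction {V : Rep k G} [Module.Finite k V] {n : ℕ}
    (i : Rep.trivial k G (Fin n → k) ⟶ V) (r : V ⟶ Rep.trivial k G (Fin n → k))
    (h : i ≫ r = 𝟙 _) : n ≤ TS V := by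
  refine le_csSup ⟨finrank k V, ?_⟩ ?_
  · rintro n ⟨W, ⟨e⟩⟩
    exact le_finrank_of_trivial_summand e
  · have : IsSplitMono i := ⟨⟨⟨r, h⟩⟩⟩
    have hb := isBilimitBinaryBiconeOfIsSplitMonoOfCokernel (cokernelIsCokernel i)
    exact ⟨cokernel i, ⟨biprod.uniqueUpToIso _ _ hb⟩⟩

lemma le_TS_of_linearMaps {V : Rep k G} [Module.Finite k V] {n : ℕ}
    (i : (Fin n → k) →ₗ[k] V) (r : V →ₗ[k] (Fin n → k)) (h : r ∘ₗ i = LinearMap.id)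
    (hi : ∀ g x, V.ρ g (i x) = i x) (hr : ∀ g v, r (V.ρ g v) = r v) : n ≤ TS V := by
  refine le_TS_of_retraction
    (Rep.ofHom (ρ := Representation.trivial k G (Fin n → k)) (σ := V.ρ)
      ⟨i, fun g => ?_⟩)
    (Rep.ofHom (ρ := V.ρ) (σ := Representation.trivial k G (Fin n → k))
      ⟨r, fun g => ?_⟩) ?_
  · ext x; simp [hi]
  · ext x; simp [hr]
  · apply Rep.hom_ext
    apply Representation.IntertwiningMap.ext
    exact h

end TrivialSummands

section Coordinates

variable (k : Type u) [Field k] (m : ℕ)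

/-- The basis of the tensor power of `k^m` given by the pure tensors of standard basis vectors,
indexed by words. -/
def tpowBasis : (n : ℕ) → Basis (Fin n → Fin m) k (tpow (natRepSL k m) n)
  | 0 => Basis.singleton (Fin 0 → Fin m) k
  | n + 1 => ((tpowBasis n).tensorProduct (Pi.basisFun k (Fin m))).reindex
      ((Equiv.prodComm _ _).trans (Fin.snocEquiv fun _ => Fin m))

instance (n : ℕ) : Module.Finite k (tpow (natRepSL k m) n) := .of_basis (tpowBasis k m n)

lemma finrank_tpow (n : ℕ) : finrank k (tpow (natRepSL k m) n) = m ^ n := by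
  simp [finrank_eq_card_basis (tpowBasis k m n)]

lemma tpowBasis_repr_apply_ρ (n : ℕ) (g : Matrix.SpecialLinearGroup (Fin m) k) (w u : Fin n → Fin m) :
    (tpowBasis k m n).repr ((tpow (natRepSL k m) n).ρ g (tpowBasis k m n u)) w =
      ∏ i, (g : Matrix (Fin m) (Fin m) k) (w i) (u i) := by
  induction n with
  | zero =>
    change (Basis.singleton (Fin 0 → Fin m) k).repr (Basis.singleton (Fin 0 → Fin m) k u) w = _
    simp
  | succ n ih =>
    change (((tpowBasis k m n).tensorProduct (Pi.basisFun k (Fin m))).reindex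
      ((Equiv.prodComm _ _).trans (Fin.snocEquiv fun _ => Fin m))).repr
        (((tpow (natRepSL k m) n).ρ.tprod (matRep Matrix.SpecialLinearGroup.toGL)) g
          (((tpowBasis k m n).tensorProduct (Pi.basisFun k (Fin m))).reindex
      ((Equiv.prodComm _ _).trans (Fin.snocEquiv fun _ => Fin m)) u)) w = _
    rw [Fin.prod_univ_castSucc, Basis.repr_reindex_apply, Basis.reindex_apply]
    simp [Basis.tensorProduct_apply', Basis.tensorProduct_repr_tmul_apply, ih, Fin.snocEquiv,
      Fin.init, matRep, mul_comm]

end Coordinates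

section Invariants

lemma det_mul_transpose_ne_zero {J W : Type*} [Fintype J] [DecidableEq J] [Fintype W]
    (X : Matrix J W ℤ) (word : J → W) (hX : ∀ i j, X i (word j) = if i = j then 1 else 0) :
    (X * X.transpose).det ≠ 0 := by
  intro h0
  obtain ⟨v, hv, h⟩ := Matrix.exists_mulVec_eq_zero_iff.mpr h0
  rw [← Matrix.mulVec_mulVec] at h
  have h1 : dotProduct (X.transpose.mulVec v) (X.transpose.mulVec v) = 0 := by
    rw [Matrix.dotProduct_mulVec, Matrix.vecMul_transpose, h, zero_dotProduct]
  rw [dotProduct_self_eq_zero] at h1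
  refine hv (funext fun j => ?_)
  simpa [Matrix.mulVec, dotProduct, hX] using congrFun h1 (word j)

lemma le_TS_of_invariants {k : Type u} [Field k] [CharZero k] {m n d : ℕ}
    (X : Matrix (Fin d) (Fin n → Fin m) ℤ) (word : Fin d → Fin n → Fin m)
    (hX : ∀ i j, X i (word j) = if i = j then 1 else 0)
    (hinv : ∀ (g : Matrix.SpecialLinearGroup (Fin m) k) j w,
      ∑ u, (∏ i, (g : Matrix (Fin m) (Fin m) k) (w i) (u i)) * (X j u : k) = X j w) :
    d ≤ TS (tpow (natRepSL k m) n) := by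
  set b := tpowBasis k m n
  let Y : Matrix (Fin d) (Fin n → Fin m) k := X.map (Int.castRingHom k)
  have hG : IsUnit (Y * Y.transpose).det := by
    have : Y * Y.transpose = (X * X.transpose).map (Int.castRingHom k) := by
      rw [Matrix.map_mul, Matrix.transpose_map]
    rw [this, ← RingHom.mapMatrix_apply, ← RingHom.map_det, isUnit_iff_ne_zero]
    simpa using det_mul_transpose_ne_zero X word hX
  let A (g : Matrix.SpecialLinearGroup (Fin m) k) : Matrix (Fin n → Fin m) (Fin n → Fin m) k :=
    Matrix.of fun w u => ∏ i, (g : Matrix (Fin m) (Fin m) k) (w i) (u i)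
  have hA (g) : Matrix.toLin b b (A g) = (tpow (natRepSL k m) n).ρ g := by
    rw [← LinearEquiv.eq_symm_apply, Matrix.toLin_symm]
    ext w u
    rw [LinearMap.toMatrix_apply, tpowBasis_repr_apply_ρ]
    rfl
  have hAY (g) : A g * Y.transpose = Y.transpose := by
    ext w j
    simpa [Matrix.mul_apply, A, Y] using hinv g j w
  have hYA (g) : Y * A g = Y := by
    ext j u
    have := hinv g.transpose j u
    simp only [Matrix.mul_apply, A, Y, Matrix.of_apply, Matrix.map_apply]
    simpa [mul_comm] using this
  let s := Pi.basisFun k (Fin d)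
  refine le_TS_of_linearMaps (Matrix.toLin s b Y.transpose)
    (Matrix.toLin b s ((Y * Y.transpose)⁻¹ * Y)) ?_ (fun g x => ?_) (fun g v => ?_)
  · rw [← Matrix.toLin_mul, Matrix.mul_assoc, Matrix.nonsing_inv_mul _ hG, Matrix.toLin_one]
  · rw [← hA, ← Matrix.toLin_mul_apply, hAY]
  · rw [← hA, ← Matrix.toLin_mul_apply, Matrix.mul_assoc, hYA]

end Invariants

section DeterminantTensors

open Equiv

/-- The Levi-Civita symbol of a word of length `m` in the alphabet `Fin m`. -/
def leviCivita {m : ℕ} (f : Fin m → Fin m) : ℤ :=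
  ((1 : Matrix (Fin m) (Fin m) ℤ).submatrix f id).det

lemma leviCivita_id {m : ℕ} : leviCivita (id : Fin m → Fin m) = 1 := by
  simp [leviCivita]

lemma injective_of_leviCivita_ne_zero {m : ℕ} {f : Fin m → Fin m} (h : leviCivita f ≠ 0) :
    Function.Injective f := by
  intro i j hij
  by_contra hne
  exact h (Matrix.det_zero_of_row_eq hne (congrArg (1 : Matrix (Fin m) (Fin m) ℤ) hij))

lemma leviCivita_cast {R : Type*} [CommRing R] {m : ℕ} (f : Fin m → Fin m) :
    (leviCivita f : R) = ((1 : Matrix (Fin m) (Fin m) R).submatrix f id).det := by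
  rw [leviCivita, ← eq_intCast (Int.castRingHom R), RingHom.map_det]
  congr 1
  ext i j
  simp [Matrix.one_apply]

lemma sum_prod_mul_leviCivita {R : Type*} [CommRing R] {m : ℕ} (M : Matrix (Fin m) (Fin m) R) :
    ∑ f : Fin m → Fin m, (∏ i, M i (f i)) * (leviCivita f : R) = M.det := by
  have hM : M = fun i => ∑ j, M i j • (1 : Matrix (Fin m) (Fin m) R) j := by
    ext i l
    simp [Finset.sum_apply, Matrix.one_apply]
  conv_rhs => rw [hM]
  change _ = Matrix.detRowAlternating.toMultilinearMap _
  rw [MultilinearMap.map_sum]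
  refine Finset.sum_congr rfl fun f _ => ?_
  rw [MultilinearMap.map_smul_univ, leviCivita_cast, smul_eq_mul]
  rfl

lemma sum_prod_mul_leviCivita_comp {R : Type*} [CommRing R] {m : ℕ}
    (g : Matrix.SpecialLinearGroup (Fin m) R) (w : Fin m → Fin m) :
    ∑ f : Fin m → Fin m, (∏ i, (g : Matrix (Fin m) (Fin m) R) (w i) (f i)) * (leviCivita f : R) =
      leviCivita w := by
  have h : (g : Matrix (Fin m) (Fin m) R).submatrix w id =
      (1 : Matrix (Fin m) (Fin m) R).submatrix w id * g := by
    ext i j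
    simp [Matrix.mul_apply, Matrix.one_apply]
  refine (sum_prod_mul_leviCivita ((g : Matrix (Fin m) (Fin m) R).submatrix w id)).trans ?_
  rw [h, Matrix.det_mul, g.det_coe, mul_one, ← leviCivita_cast]

/-- The coordinate at the word `u` of a product of copies of the determinant tensor, one for each
column of the arrangement `e` of the tensor positions. -/
def columnTensor {P C : Type*} [Fintype C] {m : ℕ} (e : P ≃ C × Fin m) (u : P → Fin m) : ℤ :=
  ∏ c, leviCivita fun i => u (e.symm (c, i))

lemma columnTensor_invariant {R : Type*} [CommRing R] {P C : Type*} [Fintype P] [DecidableEq P]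
    [Fintype C] {m : ℕ}
    (e : P ≃ C × Fin m) (g : Matrix.SpecialLinearGroup (Fin m) R) (w : P → Fin m) :
    ∑ u : P → Fin m, (∏ p, (g : Matrix (Fin m) (Fin m) R) (w p) (u p)) * (columnTensor e u : R) =
      columnTensor e w := by
  classical
  let E : (C → Fin m → Fin m) ≃ (P → Fin m) :=
    (Equiv.curry C (Fin m) (Fin m)).symm.trans (e.symm.arrowCongr (Equiv.refl _))
  rw [← E.sum_comp]
  have hterm (U : C → Fin m → Fin m) :
      (∏ p, (g : Matrix (Fin m) (Fin m) R) (w p) (E U p)) * (columnTensor e (E U) : R) =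
        ∏ c, (∏ i, (g : Matrix (Fin m) (Fin m) R) (w (e.symm (c, i))) (U c i)) *
          (leviCivita (U c) : R) := by
    rw [Finset.prod_mul_distrib, ← e.symm.prod_comp, Fintype.prod_prod_type]
    simp [columnTensor, E]
  simp_rw [hterm]
  rw [← Fintype.piFinset_univ, ← Finset.prod_univ_sum (fun _ => Finset.univ)
    (fun c f => (∏ i, (g : Matrix (Fin m) (Fin m) R) (w (e.symm (c, i))) (f i)) *
          (leviCivita f : R))]
  simp only [sum_prod_mul_leviCivita_comp g, columnTensor, Int.cast_prod]

lemma snd_eq_of_injective_columns {C : Type*} [Fintype C] {m : ℕ} (h : C → ℤ)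
    (τ : Perm (C × Fin m)) (hτ : ∀ p, h (τ p).1 + ((τ p).2 : ℤ) = h p.1 + (p.2 : ℤ))
    (hinj : ∀ c, Function.Injective fun i => (τ (c, i)).2) (p : C × Fin m) : (τ p).2 = p.2 := by
  have h1 : ∑ p : C × Fin m, (h p.1 + (p.2 : ℤ)) * ((τ p).2 : ℤ) =
      ∑ p : C × Fin m, (h p.1 + (p.2 : ℤ)) * (p.2 : ℤ) := by
    rw [← Equiv.sum_comp τ (fun p : C × Fin m => (h p.1 + (p.2 : ℤ)) * (p.2 : ℤ))]
    simp only [hτ]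
  have h2 : ∑ p : C × Fin m, h p.1 * ((τ p).2 : ℤ) = ∑ p : C × Fin m, h p.1 * (p.2 : ℤ) := by
    simp only [Fintype.sum_prod_type, ← Finset.mul_sum]
    refine Finset.sum_congr rfl fun c _ => ?_
    congr 1
    exact (Equiv.ofBijective _ (Finite.injective_iff_bijective.mp (hinj c))).sum_comp
      (fun i => (i : ℤ))
  have h3 : ∑ p : C × Fin m, ((τ p).2 : ℤ) ^ 2 = ∑ p : C × Fin m, (p.2 : ℤ) ^ 2 :=
    Equiv.sum_comp τ (fun p : C × Fin m => (p.2 : ℤ) ^ 2)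
  have h4 : ∑ p : C × Fin m, (((τ p).2 : ℤ) - p.2) ^ 2 = 0 := by
    have (p : C × Fin m) : (((τ p).2 : ℤ) - p.2) ^ 2 = ((τ p).2 : ℤ) ^ 2 + (p.2 : ℤ) ^ 2
        - 2 * ((h p.1 + (p.2 : ℤ)) * ((τ p).2 : ℤ) - h p.1 * ((τ p).2 : ℤ)) := by ring
    simp only [this, Finset.sum_sub_distrib, Finset.sum_add_distrib, ← Finset.mul_sum, h1, h2, h3]
    simp only [← Finset.sum_sub_distrib, ← Finset.sum_add_distrib, Finset.mul_sum]
    exact Finset.sum_eq_zero fun p _ => by ring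
  rw [Finset.sum_eq_zero_iff_of_nonneg fun _ _ => sq_nonneg _] at h4
  have := h4 p (Finset.mem_univ _)
  have := pow_eq_zero_iff (two_ne_zero) |>.mp this
  exact Fin.ext (by omega)

lemma columnTensor_word {P C : Type*} [Fintype C] {m : ℕ} (h : C → ℤ)
    (e e' : P ≃ C × Fin m) (he : ∀ p, h (e p).1 + ((e p).2 : ℤ) = h (e' p).1 + ((e' p).2 : ℤ))
    [Decidable ((fun p => (e p).2) = fun p => (e' p).2)] :
    columnTensor e (fun p => (e' p).2) =
      if (fun p => (e p).2) = (fun p => (e' p).2) then 1 else 0 := by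
  split_ifs with heq
  · rw [← heq]
    simp only [columnTensor, Equiv.apply_symm_apply]
    exact Finset.prod_eq_one fun _ _ => leviCivita_id
  · by_contra hne
    refine heq (funext fun p => ?_)
    have := snd_eq_of_injective_columns h (e.symm.trans e')
      (fun p => by simpa using (he (e.symm p)).symm)
      (fun c => injective_of_leviCivita_ne_zero
        (Finset.prod_ne_zero_iff.mp hne c (Finset.mem_univ _)))
      (e p)
    simpa using this.symm

lemma card_le_TS_of_arrangements {k : Type u} [Field k] [CharZero k] {m n : ℕ} {J C : Type*}
    [Fintype J] [Fintype C] (h : C → ℤ) (e : J → (Fin n ≃ C × Fin m))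
    (he : ∀ j j' p, h (e j p).1 + ((e j p).2 : ℤ) = h (e j' p).1 + ((e j' p).2 : ℤ))
    (hinj : Function.Injective fun j p => (e j p).2) :
    Fintype.card J ≤ TS (tpow (natRepSL k m) n) := by
  classical
  let f := (Fintype.equivFin J).symm
  refine le_TS_of_invariants (Matrix.of fun i => columnTensor (e (f i)))
    (fun i p => (e (f i) p).2) (fun i j => ?_)
    (fun g j w => columnTensor_invariant (e (f j)) g w)
  rw [Matrix.of_apply, columnTensor_word h _ _ (he _ _)]
  exact if_congr (hinj.eq_iff.trans f.injective.eq_iff) rfl rfl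

end DeterminantTensors

section Counting

open Equiv Nat

/-- The words of content `(q, …, q)` in the alphabet `Fin m`. -/
def balancedWords (q m : ℕ) : Finset (Fin q × Fin m → Fin m) :=
  Finset.univ.image fun τ : Perm (Fin q × Fin m) => fun p => (τ p).2

lemma factorial_le_card_balancedWords (q m : ℕ) :
    (q * m)! ≤ (q ! ^ m) * (balancedWords q m).card := by
  have h := Finset.card_le_mul_card_image
    (f := fun τ : Perm (Fin q × Fin m) => fun p => (τ p).2) Finset.univ (q ! ^ m) ?_
  · simpa [Fintype.card_perm, Finset.card_univ, balancedWords] using h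
  · intro b hb
    obtain ⟨τ₀, -, rfl⟩ := Finset.mem_image.mp hb
    have hst := DomMulAct.stabilizer_card (Prod.snd : Fin q × Fin m → Fin m)
    have hfib (i : Fin m) : Fintype.card {a : Fin q × Fin m // a.2 = i} = q := by
      rw [Fintype.card_congr (β := Fin q) ⟨fun a => a.1.1, fun a => ⟨(a, i), rfl⟩,
        fun a => by obtain ⟨⟨a, j⟩, rfl⟩ := a; rfl, fun a => rfl⟩, Fintype.card_fin]
    simp only [hfib, Finset.prod_const, Finset.card_univ, Fintype.card_fin] at hst
    rw [← hst, Fintype.card_subtype]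
    refine Finset.card_le_card_of_injOn (fun τ => τ₀.symm.trans τ) (fun τ hτ => ?_)
      (fun τ _ τ' _ h => ?_)
    · simp only [Finset.coe_filter, Finset.mem_univ, true_and, Set.mem_ofPred_eq] at hτ ⊢
      funext p
      simpa using congrFun hτ (τ₀.symm p)
    · ext1 p
      simpa using congrArg (fun σ : Perm _ => σ (τ₀ p)) h

lemma factorial_pow_mul_pow_le (m Q : ℕ) : Q ! ^ m * m ^ (m * Q) ≤ ((Q + 1) * m)! := by
  induction Q with
  | zero => simpa using Nat.one_le_iff_ne_zero.mpr (Nat.factorial_ne_zero m)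
  | succ Q ih =>
    calc (Q + 1)! ^ m * m ^ (m * (Q + 1))
        = Q ! ^ m * m ^ (m * Q) * ((Q + 1) * m) ^ m := by
          rw [Nat.factorial_succ, mul_pow, mul_pow, mul_add, pow_add, mul_one]; ring
      _ ≤ ((Q + 1) * m)! * ((Q + 1) * m + 1) ^ m := by gcongr; omega
      _ ≤ ((Q + 1) * m + m)! := Nat.factorial_mul_pow_le_factorial
      _ = ((Q + 1 + 1) * m)! := by ring_nf

lemma pow_le_card_balancedWords (m Q : ℕ) :
    m ^ (m * Q) ≤ (Q + 1) ^ m * (balancedWords (Q + 1) m).card := by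
  have h := (factorial_pow_mul_pow_le m Q).trans (factorial_le_card_balancedWords (Q + 1) m)
  rw [Nat.factorial_succ, mul_pow, mul_comm ((Q + 1) ^ m), mul_assoc] at h
  exact Nat.le_of_mul_le_mul_left h (by positivity)

/-- The embedding of `t` time slots into `t + m` columns, the letter `i` of the slot `s` being
placed in column `s + m - i`. -/
def slotEmbedding (t q m : ℕ) :
    Fin t × (Fin q × Fin m) ↪ (Fin (t + m) × Fin q) × Fin m where
  toFun x := ((⟨x.1 + m - x.2.2, by omega⟩, x.2.1), x.2.2)
  inj' := by
    rintro ⟨s, a, i⟩ ⟨s', a', i'⟩ h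
    simp only [Prod.mk.injEq, Fin.mk.injEq] at h
    obtain ⟨⟨h1, rfl⟩, rfl⟩ := h
    simp only [Prod.mk.injEq, and_true]
    omega

lemma card_balancedWords_pow_le_TS (k : Type u) [Field k] [CharZero k] (m q t : ℕ) :
    (balancedWords q m).card ^ t ≤ TS (tpow (natRepSL k m) ((t + m) * q * m)) := by
  classical
  have hB (b : balancedWords q m) : ∃ τ : Perm (Fin q × Fin m), (fun p => (τ p).2) = b.1 := by
    simpa [balancedWords] using b.2
  choose τ hτ using hB
  let F := slotEmbedding t q m
  let σ (β : Fin t → balancedWords q m) : Perm (Fin t × (Fin q × Fin m)) :=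
    Equiv.prodCongrRight fun s => τ (β s)
  let π (β : Fin t → balancedWords q m) := (σ β).viaEmbedding F
  let ε : Fin ((t + m) * q * m) ≃ (Fin (t + m) × Fin q) × Fin m :=
    (Fintype.equivFinOfCardEq (by simp)).symm
  have hF (x) : (((F x).1.1 : ℕ) : ℤ) + ((F x).2 : ℕ) = x.1 + m := by
    change ((x.1 + m - x.2.2 : ℕ) : ℤ) + (x.2.2 : ℕ) = x.1 + m
    omega
  have hπ (β p) : (((π β p).1.1 : ℕ) : ℤ) + ((π β p).2 : ℕ) = ((p.1.1 : ℕ) : ℤ) + (p.2 : ℕ) := by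
    by_cases hp : p ∈ Set.range F
    · obtain ⟨x, rfl⟩ := hp
      rw [Perm.viaEmbedding_apply, hF, hF]
      rfl
    · rw [Perm.viaEmbedding_apply_of_notMem _ _ _ hp]
  have h := card_le_TS_of_arrangements (k := k) (fun c : Fin (t + m) × Fin q => ((c.1 : ℕ) : ℤ))
    (fun β => ε.trans (π β)) (fun β β' p => ?_) (fun β β' h => ?_)
  · simpa using h
  · simp only [Equiv.trans_apply, hπ]
  · funext s
    apply Subtype.ext
    rw [← hτ, ← hτ]
    funext x
    have := congrFun h (ε.symm (F (s, x)))
    simp only [Equiv.trans_apply, Equiv.apply_symm_apply, π, Perm.viaEmbedding_apply] at this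
    exact this

end Counting

section Asymptotics

open Filter Topology

lemma tendsto_log_rate (L m : ℝ) :
    Tendsto (fun Q : ℕ => (Q * (Q * L - Real.log (Q + 1))) / ((Q + m) * (Q + 1))) atTop (𝓝 L) := by
  have h1 : Tendsto (fun Q : ℕ => (Q : ℝ) / (Q + m)) atTop (𝓝 1) :=
    tendsto_natCast_div_add_atTop m
  have h2 : Tendsto (fun Q : ℕ => (Q : ℝ) / (Q + 1)) atTop (𝓝 1) :=
    tendsto_natCast_div_add_atTop 1
  have h3 : Tendsto (fun Q : ℕ => Real.log (Q + 1) / (Q + 1)) atTop (𝓝 0) := by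
    have := (Real.isLittleO_log_id_atTop.tendsto_div_nhds_zero).comp
      (tendsto_natCast_atTop_atTop.comp (tendsto_add_atTop_nat 1) :
        Tendsto (fun n : ℕ => ((n + 1 : ℕ) : ℝ)) atTop atTop)
    simpa [Function.comp_def] using this
  have := h1.mul ((h2.mul_const L).sub h3)
  simp only [one_mul, sub_zero] at this
  refine this.congr fun Q => ?_
  rw [mul_div_mul_comm, sub_div, div_mul_eq_mul_div (Q : ℝ) (Q + 1 : ℝ) L]

lemma tendsto_rate {m : ℕ} (hm : m ≠ 0) :
    Tendsto (fun Q : ℕ => (((m : ℝ) ^ (m * Q) / (Q + 1) ^ m) ^ Q) ^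
      ((((Q + m) * (Q + 1) * m : ℕ) : ℝ)⁻¹)) atTop (𝓝 m) := by
  have hm' : (0 : ℝ) < m := by positivity
  have h := (tendsto_log_rate (Real.log m) m).rexp
  rw [Real.exp_log hm'] at h
  refine h.congr fun Q => ?_
  have hQ : (0 : ℝ) < Q + 1 := by positivity
  rw [Real.rpow_def_of_pos (by positivity), Real.log_pow, Real.log_div (by positivity)
    (by positivity), Real.log_pow, Real.log_pow]
  congr 1
  push_cast
  field_simp

end Asymptotics

/-- **Theorem.** For the natural representation `V = k^m` of `SL_m(k)` in characteristic
zero, `d(SL(V), V) = limsup TS(V^{⊗n})^{1/n} = m`. -/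
theorem dG_SL_natural_eq_dim {k : Type u} [Field k] [IsAlgClosed k] [CharZero k] (m : ℕ) :
    dG (natRepSL k m) = (m : ℝ) := by
  have hle (n : ℕ) : TS (tpow (natRepSL k m) n) ≤ m ^ n :=
    (TS_le_finrank _).trans_eq (finrank_tpow k m n)
  have hnonneg (n : ℕ) : 0 ≤ (TS (tpow (natRepSL k m) n) : ℝ) ^ ((n : ℝ)⁻¹) := by positivity
  have hub : ∀ᶠ n : ℕ in Filter.atTop, (TS (tpow (natRepSL k m) n) : ℝ) ^ ((n : ℝ)⁻¹) ≤ m := by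
    filter_upwards [Filter.eventually_ne_atTop 0] with n hn
    calc (TS (tpow (natRepSL k m) n) : ℝ) ^ ((n : ℝ)⁻¹) ≤ ((m : ℝ) ^ n) ^ ((n : ℝ)⁻¹) := by
          gcongr
          exact_mod_cast hle n
      _ = m := Real.pow_rpow_inv_natCast (by positivity) hn
  have hbdd : Filter.IsBoundedUnder (· ≤ ·) Filter.atTop
      fun n : ℕ => (TS (tpow (natRepSL k m) n) : ℝ) ^ ((n : ℝ)⁻¹) := ⟨m, hub⟩
  refine le_antisymm (Filter.limsup_le_of_le (Filter.isCoboundedUnder_le_of_le _ hnonneg) hub) ?_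
  rcases eq_or_ne m 0 with rfl | hm
  · rw [Nat.cast_zero]
    exact Filter.le_limsup_of_frequently_le (Filter.Frequently.of_forall hnonneg) hbdd
  refine le_of_forall_lt fun a ha => ?_
  obtain ⟨b, hab, hb⟩ := exists_between ha
  refine hab.trans_le (Filter.le_limsup_of_frequently_le ?_ hbdd)
  have hN : Filter.Tendsto (fun Q : ℕ => (Q + m) * (Q + 1) * m) Filter.atTop Filter.atTop :=
    Filter.tendsto_atTop_mono (fun Q => (Nat.le_add_right Q m).trans
      ((Nat.le_mul_of_pos_right _ (Nat.succ_pos Q)).trans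
        (Nat.le_mul_of_pos_right _ (Nat.pos_of_ne_zero hm)))) Filter.tendsto_id
  refine hN.frequently (Filter.Eventually.frequently ?_)
  filter_upwards [(tendsto_rate hm).eventually_const_lt hb] with Q hQ
  refine hQ.le.trans ?_
  gcongr
  refine le_trans ?_ (Nat.cast_le.mpr (card_balancedWords_pow_le_TS k m (Q + 1) Q))
  rw [Nat.cast_pow]
  gcongr
  rw [div_le_iff₀' (by positivity)]
  exact_mod_cast pow_le_card_balancedWords m Q
end
end
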